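/- Let f_1,…,f_m ∈ ℂ[x_1,…,x_n] be pairwise non-proportional linear forms with m > n defining a hyperplane arrangement A. If A is tame, i.e., the projective dimension of Ω^p(A) over R is at most p for all 0 ≤ p ≤ r(A), then A is gentle, i.e., I_0(A) = I(A). -/

import Mathlib

open MvPolynomial

noncomputable section

/-- The polynomial ring `R = ℂ[x_1,…,x_n]`. -/
abbrev PolyR (n : ℕ) : Type := MvPolynomial (Fin n) ℂ

/-- The polynomial ring `ℂ[x_1,…,x_n,s_i : i ∈ ι]`. -/
abbrev PolyRS (n : ℕ) (ι : Type) : Type := MvPolynomial (Fin n ⊕ ι) ℂ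

variable {n : ℕ} {ι : Type} [Fintype ι]

/-- The `R`-linear map given by the matrix `Q`, sending `(a, b)` to the vector with
`i`-th entry `a_i f_i + Σ_j b_j ∂f_i/∂x_j`. -/
def Qmap (f : ι → PolyR n) :
    ((ι → PolyR n) × (Fin n → PolyR n)) →ₗ[PolyR n] (ι → PolyR n) where
  toFun ab := fun i => ab.1 i * f i + ∑ j, ab.2 j * pderiv j (f i)
  map_add' x y := by
    funext i
    simp only [Prod.fst_add, Prod.snd_add, Pi.add_apply, add_mul, Finset.sum_add_distrib]
    ring
  map_smul' r x := by
    funext i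
    simp only [Prod.smul_fst, Prod.smul_snd, Pi.smul_apply, smul_eq_mul, RingHom.id_apply,
      mul_assoc, ← Finset.mul_sum]
    ring

/-- The `R`-linear map given by the Jacobian matrix `Jac(F)`. -/
def jacMap (f : ι → PolyR n) : (Fin n → PolyR n) →ₗ[PolyR n] (ι → PolyR n) where
  toFun b := fun i => ∑ j, b j * pderiv j (f i)
  map_add' x y := by
    funext i
    simp only [Pi.add_apply, add_mul, Finset.sum_add_distrib]
  map_smul' r x := by
    funext i
    simp only [Pi.smul_apply, smul_eq_mul, RingHom.id_apply, mul_assoc, ← Finset.mul_sum]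

/-- The log-derivation module `logDer(A) ⊆ R^m`. -/
def logDer (f : ι → PolyR n) : Submodule (PolyR n) (ι → PolyR n) where
  carrier := {a | ∃ b : Fin n → PolyR n, ∀ i, a i * f i + ∑ j, b j * pderiv j (f i) = 0}
  zero_mem' := ⟨0, fun i => by simp⟩
  add_mem' := by
    rintro a a' ⟨b, hb⟩ ⟨b', hb'⟩
    refine ⟨b + b', fun i => ?_⟩
    have h1 := hb i
    have h2 := hb' i
    simp only [Pi.add_apply, add_mul, Finset.sum_add_distrib]
    linear_combination h1 + h2
  smul_mem' := by
    rintro c a ⟨b, hb⟩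
    refine ⟨c • b, fun i => ?_⟩
    have h1 := hb i
    simp only [Pi.smul_apply, smul_eq_mul, mul_assoc, ← Finset.mul_sum]
    linear_combination c * h1

/-- The pre-likelihood ideal `I₀(A) ⊆ ℂ[x,s]`, generated by the polynomials
`Σ_i a_i s_i` for `a ∈ logDer(A)`. -/
def preLikelihoodIdeal (f : ι → PolyR n) : Ideal (PolyRS n ι) :=
  Ideal.span {g | ∃ a ∈ logDer f, g = ∑ i, rename Sum.inl (a i) * X (Sum.inr i)}

/-- The Jacobian matrix of `F = (f_1,…,f_m)` evaluated at a point `x ∈ ℂ^n`. -/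
def jacAt (f : ι → PolyR n) (x : Fin n → ℂ) : Matrix ι (Fin n) ℂ :=
  Matrix.of fun i j => eval x (pderiv j (f i))

/-- The maximal rank of the Jacobian matrix over all points of `ℂ^n`. -/
def jacMaxRank (f : ι → PolyR n) : ℕ :=
  ⨆ x : Fin n → ℂ, (jacAt f x).rank

/-- The critical-point locus of the log-likelihood `ℓ_A = Σ_j s_j log f_j`,
with denominators cleared, together with the maximal-rank regularity condition. -/
def critLocus [DecidableEq ι] (f : ι → PolyR n) : Set ((Fin n → ℂ) × (ι → ℂ)) :=
  {p | (∀ j, eval p.1 (f j) ≠ 0) ∧ (jacAt f p.1).rank = jacMaxRank f ∧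
    ∀ i : Fin n, ∑ j, p.2 j * eval p.1 (pderiv i (f j)) *
      ∏ k ∈ Finset.univ.erase j, eval p.1 (f k) = 0}

/-- The likelihood ideal `I(A)`: all polynomials in `ℂ[x,s]` vanishing on the
critical-point locus. -/
def likelihoodIdeal [DecidableEq ι] (f : ι → PolyR n) : Ideal (PolyRS n ι) where
  carrier := {g | ∀ p ∈ critLocus f, eval (Sum.elim p.1 p.2) g = 0}
  zero_mem' := fun p _ => by simp
  add_mem' := fun {a b} ha hb p hp => by simp [map_add, ha p hp, hb p hp]
  smul_mem' := fun c g hg p hp => by simp [smul_eq_mul, hg p hp]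

/-- An arrangement is gentle if its pre-likelihood ideal equals its likelihood ideal. -/
def IsGentle [DecidableEq ι] (f : ι → PolyR n) : Prop :=
  preLikelihoodIdeal f = likelihoodIdeal f

/-- The module `Der(A)` of `A`-derivations: derivations `θ` with `θ(f) ∈ ⟨f⟩`,
where `f = f_1 ⋯ f_m`. -/
def DerA (f : ι → PolyR n) : Submodule (PolyR n) (Derivation ℂ (PolyR n) (PolyR n)) where
  carrier := {θ | θ (∏ i, f i) ∈ Ideal.span {∏ i, f i}}
  zero_mem' := by simp
  add_mem' := by
    intro a b ha hb
    simpa using Ideal.add_mem _ ha hb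
  smul_mem' := by
    intro c θ hθ
    simpa [smul_eq_mul] using Ideal.mul_mem_left _ c hθ

/-- `ProjDimLE R k M` means the `R`-module `M` has projective dimension at most `k`. -/
def ProjDimLE (R : Type) [CommRing R] : ℕ → ModuleCat R → Prop
  | 0, M => Module.Projective R M
  | k + 1, M => ∃ (κ : Type) (p : (κ →₀ R) →ₗ[R] M), Function.Surjective p ∧
      ProjDimLE R k (ModuleCat.of R ↥(LinearMap.ker p))

/-- `Ω¹(A) = Hom_R(Der(A), R)`, the module of logarithmic differentials. -/
abbrev OmegaOne (f : ι → PolyR n) : Type := Module.Dual (PolyR n) ↥(DerA f)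

/-- `Ω^p(A)`: the double `R`-dual of the `p`-th exterior power of `Ω¹(A)`. -/
abbrev OmegaP (f : ι → PolyR n) (p : ℕ) : Type :=
  Module.Dual (PolyR n) (Module.Dual (PolyR n) ↥(⋀[PolyR n]^p (OmegaOne f)))

/-- `r(A)`: the smallest integer `r` such that `Ω^p(A) = 0` for all `p > r`. -/
def arrRank (f : ι → PolyR n) : ℕ :=
  sInf {r : ℕ | ∀ p : ℕ, r < p → Subsingleton (OmegaP f p)}

/-- The arrangement `A` is tame if `pd_R(Ω^p(A)) ≤ p` for all `0 ≤ p ≤ r(A)`. -/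
def IsTame (f : ι → PolyR n) : Prop :=
  ∀ p : ℕ, p ≤ arrRank f → ProjDimLE (PolyR n) p (ModuleCat.of (PolyR n) (OmegaP f p))

open CategoryTheory CategoryTheory.Abelian RingTheory.Sequence in
/-- If every element of a weakly `M`-regular sequence kills `N`, then `Ext^i(N, M) = 0` for all `i`
below the length of the sequence. -/
lemma subsingleton_ext_of_isWeaklyRegular {A : Type} [CommRing A] (N : ModuleCat.{0} A)
    (rs : List A) (hN : ∀ a ∈ rs, ∀ x : N, a • x = 0) (M : ModuleCat.{0} A)
    (hM : IsWeaklyRegular M rs) (i : ℕ) (hi : i < rs.length) :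
    Subsingleton (Ext N M i) := by
  induction rs generalizing M i with
  | nil => simp at hi
  | cons a rs ih =>
    rw [isWeaklyRegular_cons_iff] at hM
    have ha : ∀ x : N, a • x = 0 := hN a (by simp)
    obtain _ | i := i
    · have : Subsingleton (N →ₗ[A] M) := ⟨fun f g => by
        ext x
        apply hM.1
        change a • f x = a • g x
        rw [← map_smul, ← map_smul, ha, map_zero, map_zero]⟩
      exact (Ext.addEquiv₀.trans ModuleCat.homAddEquiv).subsingleton
    · have h := ih (fun b hb => hN b (by simp [hb])) (ModuleCat.of A (QuotSMulTop a M)) hM.2 i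
        (by simpa using hi)
      refine subsingleton_of_forall_eq 0 fun x => ?_
      have hSE := IsSMulRegular.smulShortComplex_shortExact (M := M) hM.1
      have hx : x.comp (Ext.mk₀ (M.smulShortComplex a).f) (add_zero (i + 1)) = 0 := by
        have h1 : a • 𝟙 N = 0 := by
          ext y
          exact ha y
        rw [ModuleCat.smulShortComplex_f_eq_smul_id]
        change x.comp (Ext.mk₀ (a • 𝟙 M)) (add_zero (i + 1)) = 0
        rw [Ext.mk₀_smul, Ext.comp_smul, Ext.comp_mk₀_id, ← Ext.mk₀_id_comp x, ← Ext.smul_comp,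
          ← Ext.mk₀_smul, h1, Ext.mk₀_zero, Ext.zero_comp]
      obtain ⟨y, rfl⟩ := Ext.covariant_sequence_exact₁ N hSE x hx rfl
      rw [show y = 0 from @Subsingleton.elim _ h _ _, Ext.zero_comp]
      rfl

open CategoryTheory CategoryTheory.Abelian in
lemma subsingleton_ext_right {A : Type} [CommRing A] (N : ModuleCat.{0} A)
    {X Y Z : Type} [AddCommGroup X] [Module A X] [AddCommGroup Y] [Module A Y] [AddCommGroup Z]
    [Module A Z] (f : X →ₗ[A] Y) (g : Y →ₗ[A] Z) (hf : Function.Injective f)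
    (hg : Function.Surjective g) (hfg : Function.Exact f g) {i : ℕ}
    (hY : Subsingleton (Ext N (ModuleCat.of A Y) i))
    (hX : Subsingleton (Ext N (ModuleCat.of A X) (i + 1))) :
    Subsingleton (Ext N (ModuleCat.of A Z) i) := by
  let S : ShortComplex (ModuleCat.{0} A) := ShortComplex.mk (ModuleCat.ofHom f) (ModuleCat.ofHom g)
    (by ext x; exact hfg.apply_apply_eq_zero x)
  have hS : S.ShortExact := 
    { exact := (ShortComplex.ShortExact.moduleCat_exact_iff_function_exact S).2 hfg
      mono_f := (ModuleCat.mono_iff_injective _).2 hf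
      epi_g := (ModuleCat.epi_iff_surjective _).2 hg }
  refine subsingleton_of_forall_eq 0 fun x => ?_
  obtain ⟨y, rfl⟩ := Ext.covariant_sequence_exact₃ N hS x rfl (@Subsingleton.elim _ hX _ _)
  rw [show y = 0 from @Subsingleton.elim _ hY _ _, Ext.zero_comp]

open CategoryTheory CategoryTheory.Abelian TensorProduct in
lemma subsingleton_ext_baseChange {R A : Type} [CommRing R] [CommRing A] [Algebra R A]
    [Module.Flat R A] (N : ModuleCat.{0} A) {Y M : Type} [AddCommGroup Y] [Module R Y]
    [AddCommGroup M] [Module R M] (p : Y →ₗ[R] M) (hp : Function.Surjective p) {i : ℕ}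
    (hY : Subsingleton (Ext N (ModuleCat.of A (A ⊗[R] Y)) i))
    (hK : Subsingleton (Ext N (ModuleCat.of A (A ⊗[R] LinearMap.ker p)) (i + 1))) :
    Subsingleton (Ext N (ModuleCat.of A (A ⊗[R] M)) i) := by
  refine subsingleton_ext_right N ((LinearMap.ker p).subtype.baseChange A) (p.baseChange A)
    ?_ ?_ ?_ hY hK
  · exact Module.Flat.lTensor_preserves_injective_linearMap _ Subtype.val_injective
  · exact LinearMap.lTensor_surjective A hp
  · exact lTensor_exact A (LinearMap.exact_subtype_ker_map p) hp

open CategoryTheory CategoryTheory.Abelian RingTheory.Sequence TensorProduct in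
/-- Base change of a module of projective dimension at most `k` along a flat algebra with a weakly
regular sequence of length `K` killing `N` has vanishing `Ext^i(N, -)` for `i + k < K`. -/
lemma subsingleton_ext_of_projDimLE {R A : Type} [CommRing R] [CommRing A] [Algebra R A]
    [Module.Flat R A] (N : ModuleCat.{0} A) (rs : List A) (hN : ∀ a ∈ rs, ∀ x : N, a • x = 0)
    (hrs : IsWeaklyRegular A rs) (k : ℕ) (M : Type) [AddCommGroup M] [Module R M]
    (hM : ProjDimLE R k (ModuleCat.of R M)) (i : ℕ) (hi : i + k < rs.length) :
    Subsingleton (Ext N (ModuleCat.of A (A ⊗[R] M)) i) := by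
  have hflat : ∀ (Q : Type) [AddCommGroup Q] [Module A Q] [Module.Flat A Q] (j : ℕ),
      j < rs.length → Subsingleton (Ext N (ModuleCat.of A Q) j) := by
    intro Q _ _ _ j hj
    refine subsingleton_ext_of_isWeaklyRegular N rs hN _ ?_ j hj
    exact ((TensorProduct.lid A Q).isWeaklyRegular_congr rs).1 (hrs.isWeaklyRegular_rTensor)
  induction k generalizing M i with
  | zero =>
    have : Module.Projective R M := hM
    exact hflat _ _ hi
  | succ k ih =>
    obtain ⟨κ, p, hp, hk⟩ := hM
    exact subsingleton_ext_baseChange N (Y := κ →₀ R) p hp (hflat _ i (by omega))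
      (ih _ hk (i + 1) (by omega))

open CategoryTheory CategoryTheory.Abelian in
/-- A depth argument in the style of the acyclicity lemma. Let `d` be maps `C 0 → C 1 → ⋯` and
`B q ⊆ C q` their images, with `ker d_q = B q` for `q < p`. If `Ext^i(A ⧸ I, C q)` vanishes for
`i + q ≤ p`, then `C p ⧸ B p` has no nonzero element killed by `I`. -/
lemma mem_of_forall_smul_mem {A : Type} [CommRing A] (I : Ideal A) (C : ℕ → Type)
    [∀ q, AddCommGroup (C q)] [∀ q, Module A (C q)] (d : ∀ q, C q →ₗ[A] C (q + 1))
    (B : ∀ q, Submodule A (C q)) (hB0 : B 0 = ⊥) (hB : ∀ q, B (q + 1) = LinearMap.range (d q))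
    (p : ℕ) (hex : ∀ q < p, LinearMap.ker (d q) = B q)
    (hC : ∀ q i, i + q ≤ p →
      Subsingleton (Ext (ModuleCat.of A (A ⧸ I)) (ModuleCat.of A (C q)) i))
    (h : C p) (hI : ∀ a ∈ I, a • h ∈ B p) : h ∈ B p := by
  have key : ∀ q ≤ p, ∀ i, i + q ≤ p + 1 →
      Subsingleton (Ext (ModuleCat.of A (A ⧸ I)) (ModuleCat.of A (B q)) i) := by
    intro q
    induction q with
    | zero =>
      intro _ i _
      rw [hB0]
      have : Limits.IsZero (ModuleCat.of A (⊥ : Submodule A (C 0))) :=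
        ModuleCat.isZero_of_subsingleton _
      exact subsingleton_of_forall_eq 0 fun x => by
        rw [← Ext.comp_mk₀_id x, this.eq_zero_of_tgt (𝟙 _), Ext.mk₀_zero, Ext.comp_zero]
    | succ q ih =>
      intro hq i hi
      rw [hB]
      refine subsingleton_ext_right _ (B q).subtype (d q).rangeRestrict Subtype.val_injective
        (d q).surjective_rangeRestrict ?_ (hC q i (by omega)) (ih (by omega) _ (by omega))
      rw [LinearMap.exact_iff, LinearMap.ker_rangeRestrict, Submodule.range_subtype,
        hex q (by omega)]
  have h0 : Subsingleton (Ext (ModuleCat.of A (A ⧸ I)) (ModuleCat.of A (C p ⧸ B p)) 0) :=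
    subsingleton_ext_right _ (B p).subtype (B p).mkQ Subtype.val_injective
      (Submodule.mkQ_surjective _) (LinearMap.exact_subtype_mkQ _) (hC p 0 (by omega))
      (key p le_rfl 1 (by omega))
  have h1 : Subsingleton ((A ⧸ I) →ₗ[A] (C p ⧸ B p)) :=
    (Ext.addEquiv₀.trans (ModuleCat.homAddEquiv (M := ModuleCat.of A (A ⧸ I))
      (N := ModuleCat.of A (C p ⧸ B p)))).symm.subsingleton
  have hle : I ≤ LinearMap.ker (LinearMap.toSpanSingleton A _ ((B p).mkQ h)) := by
    intro a ha
    rw [LinearMap.mem_ker, LinearMap.toSpanSingleton_apply, ← map_smul]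
    exact (Submodule.Quotient.mk_eq_zero _).2 (hI a ha)
  have h2 := LinearMap.congr_fun (h1.elim (Submodule.liftQ I _ hle) 0) (Submodule.Quotient.mk 1)
  rw [Submodule.liftQ_apply, LinearMap.toSpanSingleton_apply, one_smul, LinearMap.zero_apply] at h2
  exact (Submodule.Quotient.mk_eq_zero _).1 h2

open RingTheory.Sequence in
lemma isWeaklyRegular_concat {A : Type*} [CommRing A] {rs : List A} {a : A}
    (h : IsWeaklyRegular A rs) (ha : ∀ x, a * x ∈ Ideal.ofList rs → x ∈ Ideal.ofList rs) :
    IsWeaklyRegular A (rs ++ [a]) := by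
  rw [isWeaklyRegular_append_iff, isWeaklyRegular_singleton_iff]
  refine ⟨h, (isSMulRegular_iff_right_eq_zero_of_smul).2 fun x hx => ?_⟩
  induction x using Submodule.Quotient.induction_on with
  | H x =>
    rw [← Submodule.Quotient.mk_smul] at hx
    rw [Submodule.Quotient.mk_eq_zero] at hx ⊢
    simp only [smul_eq_mul, Ideal.mul_top] at hx ⊢
    exact ha x hx

lemma mem_map_C_sup_span_X_iff {σ D : Type*} [CommRing D] (J : Ideal D) (s : Set σ)
    (x : MvPolynomial σ D) :
    x ∈ J.map C ⊔ Ideal.span (X '' s : Set (MvPolynomial σ D)) ↔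
      ∀ α : σ →₀ ℕ, (∀ τ ∈ s, α τ = 0) → coeff α x ∈ J := by
  constructor
  · intro hx α hα
    obtain ⟨a, ha, b, hb, rfl⟩ := Submodule.mem_sup.1 hx
    rw [coeff_add]
    refine J.add_mem (mem_map_C_iff.1 ha α) ?_
    rw [mem_ideal_span_X_image] at hb
    have : coeff α b = 0 := by
      by_contra h
      obtain ⟨i, hi, h2⟩ := hb α (mem_support_iff.2 h)
      exact h2 (hα i hi)
    simp [this]
  · intro h
    rw [x.as_sum]
    refine Ideal.sum_mem _ fun α _ => ?_
    by_cases hα : ∀ τ ∈ s, α τ = 0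
    · refine Ideal.mem_sup_left (mem_map_C_iff.2 fun β => ?_)
      classical
      rw [coeff_monomial]
      split_ifs with h1
      · exact h α hα
      · exact J.zero_mem
    · push Not at hα
      obtain ⟨τ, hτ, hτ'⟩ := hα
      refine Ideal.mem_sup_right (mem_ideal_span_X_image.2 fun β hβ => ⟨τ, hτ, ?_⟩)
      have := support_monomial_subset hβ
      rw [Finset.mem_singleton] at this
      rwa [this]

open RingTheory.Sequence in
lemma isWeaklyRegular_map_C_append_map_X {σ D : Type*} [CommRing D] {ys : List D}
    (hys : IsWeaklyRegular D ys) (Θ : List σ) (hΘ : Θ.Nodup) :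
    IsWeaklyRegular (MvPolynomial σ D) (ys.map C ++ Θ.map X) := by
  induction Θ using List.reverseRecOn with
  | nil => simpa using hys.of_flat (S := MvPolynomial σ D)
  | append_singleton Θ τ ih =>
    rw [List.map_append, ← List.append_assoc]
    rw [List.nodup_append] at hΘ
    refine isWeaklyRegular_concat (ih hΘ.1) fun x hx => ?_
    have e : Ideal.ofList (ys.map C ++ Θ.map X) = (Ideal.ofList ys).map (C : D →+* _) ⊔
        Ideal.span (X '' {i | i ∈ Θ} : Set (MvPolynomial σ D)) := by
      rw [Ideal.ofList_append, ← Ideal.map_ofList]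
      congr 2
      simp [Ideal.ofList, Set.image]
    rw [e, mem_map_C_sup_span_X_iff] at hx ⊢
    intro α hα
    have := hx (Finsupp.single τ 1 + α) fun ρ hρ => by
      have hne : τ ≠ ρ := fun h => hΘ.2.2 ρ hρ τ (by simp) h.symm
      simp [hne, hα ρ hρ]
    rwa [coeff_X_mul] at this

open RingTheory.Sequence in
/-- Linear forms whose coefficient matrix is the identity on `Θ × Θ` form, together with a weakly
regular sequence of constants, a weakly regular sequence. -/
lemma isWeaklyRegular_map_C_append_map_linear {σ D : Type*} [CommRing D] [Fintype σ]
    {ys : List D} (hys : IsWeaklyRegular D ys) (Θ : List σ) (hΘ : Θ.Nodup) (c : σ → σ → D)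
    (hc : ∀ τ ∈ Θ, ∀ ρ ∈ Θ, ρ ≠ τ → c τ ρ = 0) (hc1 : ∀ τ ∈ Θ, c τ τ = 1) :
    IsWeaklyRegular (MvPolynomial σ D)
      (ys.map C ++ Θ.map fun τ => ∑ ρ, C (c τ ρ) * X ρ) := by
  classical
  let d : σ → σ → D := fun τ ρ => if τ ∈ Θ ∧ ρ ∉ Θ then c τ ρ else 0
  have hd : ∀ τ ρ ρ', d τ ρ * d ρ ρ' = 0 := by
    intro τ ρ ρ'
    simp only [d]
    split_ifs <;> simp_all
  let F : D → MvPolynomial σ D →ₐ[D] MvPolynomial σ D := fun u =>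
    aeval fun τ => X τ + C u * ∑ ρ, C (d τ ρ) * X ρ
  have hF : ∀ u v, u + v = 0 → (F u).comp (F v) = AlgHom.id D _ := by
    intro u v huv
    ext τ : 1
    have h1 : (F u) (∑ ρ, C (d τ ρ) * X ρ) = ∑ ρ, C (d τ ρ) * X ρ := by
      simp only [F, map_sum, map_mul, aeval_X, algHom_C, algebraMap_eq]
      refine Finset.sum_congr rfl fun ρ _ => ?_
      rw [mul_add, mul_left_comm, Finset.mul_sum]
      simp only [← mul_assoc, ← C_mul, hd]
      simp
    have h2 : F u (X τ) = X τ + C u * ∑ ρ, C (d τ ρ) * X ρ := by simp [F]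
    have h3 : F v (X τ) = X τ + C v * ∑ ρ, C (d τ ρ) * X ρ := by simp [F]
    rw [AlgHom.comp_apply, h3, map_add, map_mul, h1, h2, algHom_C, algebraMap_eq, add_assoc,
      ← add_mul, ← C_add, huv]
    simp
  let e : MvPolynomial σ D ≃ₐ[D] MvPolynomial σ D :=
    AlgEquiv.ofAlgHom (F 1) (F (-1)) (hF _ _ (by ring)) (hF _ _ (by ring))
  have key := isWeaklyRegular_map_C_append_map_X hys Θ hΘ
  have key' := (e.toAddEquiv.isWeaklyRegular_congr (M := MvPolynomial σ D)
    (M₂ := MvPolynomial σ D) (as := ys.map C ++ Θ.map X) (bs := (ys.map C ++ Θ.map X).map e)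
    (List.forall₂_map_right_iff.2 (List.forall₂_same.2 fun a _ x => map_mul e a x))).1 key
  convert key' using 1
  rw [List.map_append, List.map_map, List.map_map]
  congr 1
  · refine List.map_congr_left fun a _ => (e.commutes a).symm
  · refine List.map_congr_left fun τ hτ => ?_
    have h3 : e (X τ) = X τ + C 1 * ∑ ρ, C (d τ ρ) * X ρ := by simp [e, F]
    rw [Function.comp_apply, h3, C_1, one_mul, ← Finset.add_sum_erase _ _ (Finset.mem_univ τ),
      ← Finset.add_sum_erase _ _ (Finset.mem_univ τ), hc1 τ hτ]
    have : d τ τ = 0 := by simp [d, hτ]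
    rw [this, C_0, C_1, zero_mul, zero_add, one_mul]
    congr 1
    refine Finset.sum_congr rfl fun ρ hρ => ?_
    by_cases h : ρ ∈ Θ
    · simp [d, h, hc τ hτ ρ h (Finset.ne_of_mem_erase hρ)]
    · simp [d, h, hτ]

/-- The linear form with coefficient vector `v`. -/
def linForm {n : ℕ} : (Fin n → ℂ) →ₗ[ℂ] PolyR n :=
  Fintype.linearCombination ℂ (fun j => (X j : PolyR n))

lemma linForm_apply {n : ℕ} (v : Fin n → ℂ) : linForm v = ∑ j, v j • (X j : PolyR n) := rfl

lemma linForm_single {n : ℕ} (j : Fin n) : linForm (Pi.single j 1) = (X j : PolyR n) := by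
  simp [linForm_apply, Pi.single_apply]

/-- A basis of `ℂ^n` gives polynomial coordinates on `ℂ[x_1,…,x_n]`. -/
def linFormEquiv {n : ℕ} {κ : Type*} (b : Module.Basis κ ℂ (Fin n → ℂ)) :
    MvPolynomial κ ℂ ≃ₐ[ℂ] PolyR n :=
  AlgEquiv.ofAlgHom (aeval fun k => linForm (b k))
    (aeval fun j => (Finsupp.linearCombination ℂ X) (b.repr (Pi.single j 1)))
    (by
      ext j : 1
      have h : ∀ w : κ →₀ ℂ, aeval (fun k => linForm (b k))
          (Finsupp.linearCombination ℂ (X : κ → MvPolynomial κ ℂ) w) =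
          linForm (b.repr.symm w) := by
        intro w
        rw [← AlgHom.toLinearMap_apply, Finsupp.apply_linearCombination, b.repr_symm_apply,
          Finsupp.apply_linearCombination]
        congr 2
        ext k
        simp
      simp only [AlgHom.comp_apply, aeval_X, AlgHom.id_apply]
      rw [h, LinearEquiv.symm_apply_apply, linForm_single])
    (by
      ext k : 1
      have h : ∀ v : Fin n → ℂ,
          aeval (fun j => (Finsupp.linearCombination ℂ (X : κ → MvPolynomial κ ℂ))
            (b.repr (Pi.single j 1))) (linForm v) =
          (Finsupp.linearCombination ℂ (X : κ → MvPolynomial κ ℂ)) (b.repr v) := by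
        intro v
        rw [linForm_apply, map_sum]
        simp only [map_smul, aeval_X]
        simp only [← map_smul, ← map_sum]
        congr 2
        ext i
        simp [Pi.single_apply]
      simp only [AlgHom.comp_apply, aeval_X, AlgHom.id_apply]
      rw [h]
      simp)

open RingTheory.Sequence in
lemma isWeaklyRegular_map_linForm {n : ℕ} {κ : Type*} (b : Module.Basis κ ℂ (Fin n → ℂ))
    (Θ : List κ) (hΘ : Θ.Nodup) :
    IsWeaklyRegular (PolyR n) (Θ.map fun k => linForm (b k)) := by
  have key := isWeaklyRegular_map_C_append_map_X (IsWeaklyRegular.nil ℂ ℂ) Θ hΘ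
  rw [List.map_nil, List.nil_append] at key
  let e := linFormEquiv b
  have key' := (e.toAddEquiv.isWeaklyRegular_congr (M := MvPolynomial κ ℂ)
    (M₂ := PolyR n) (as := Θ.map X) (bs := (Θ.map X).map e)
    (List.forall₂_map_right_iff.2 (List.forall₂_same.2 fun a _ x => map_mul e a x))).1 key
  rw [List.map_map] at key'
  convert key' using 2
  ext k : 1
  simp [e, linFormEquiv]

section Wedge

variable {R M : Type} [CommRing R] [AddCommGroup M] [Module R M]

/-- Left multiplication by `ω ∈ M` on the exterior powers of `M`. -/
def wedgeLeft (ω : M) (p : ℕ) : ⋀[R]^p M →ₗ[R] ⋀[R]^(p + 1) M :=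
  (LinearMap.mulLeft R (ExteriorAlgebra.ι R ω)).restrict fun x hx => by
    change _ ∈ (LinearMap.range (ExteriorAlgebra.ι R : M →ₗ[R] _)) ^ (p + 1)
    rw [pow_succ']
    exact Submodule.mul_mem_mul ⟨ω, rfl⟩ hx

@[simp]
lemma wedgeLeft_coe (ω : M) (p : ℕ) (x : ⋀[R]^p M) :
    (wedgeLeft ω p x : ExteriorAlgebra R M) = ExteriorAlgebra.ι R ω * x := rfl

lemma contractLeft_mem (ξ : Module.Dual R M) (p : ℕ) (x : ExteriorAlgebra R M)
    (hx : x ∈ ⋀[R]^(p + 1) M) : CliffordAlgebra.contractLeft (Q := 0) ξ x ∈ ⋀[R]^p M := by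
  induction p generalizing x with
  | zero =>
    have hx' : x ∈ LinearMap.range (ExteriorAlgebra.ι R : M →ₗ[R] _) := by simpa using hx
    obtain ⟨m, rfl⟩ := hx'
    rw [ExteriorAlgebra.ι, CliffordAlgebra.contractLeft_ι]
    change _ ∈ (LinearMap.range (ExteriorAlgebra.ι R : M →ₗ[R] _)) ^ 0
    rw [pow_zero]
    exact Submodule.algebraMap_mem _
  | succ p ih =>
    change x ∈ (LinearMap.range (ExteriorAlgebra.ι R : M →ₗ[R] _)) ^ (p + 1 + 1) at hx
    rw [pow_succ'] at hx
    induction hx using Submodule.mul_induction_on' with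
    | mem_mul_mem a ha b hb =>
      obtain ⟨m, rfl⟩ := ha
      rw [ExteriorAlgebra.ι, CliffordAlgebra.contractLeft_ι_mul]
      refine Submodule.sub_mem _ (Submodule.smul_mem _ _ hb) ?_
      exact (wedgeLeft m p ⟨_, ih b hb⟩).2
    | add x _ y _ hx hy => 
      rw [map_add]
      exact Submodule.add_mem _ hx hy

/-- Contraction with `ξ ∈ Mᵛ` on the exterior powers of `M`. -/
def contr (ξ : Module.Dual R M) (p : ℕ) : ⋀[R]^(p + 1) M →ₗ[R] ⋀[R]^p M :=
  (CliffordAlgebra.contractLeft (Q := 0) ξ).restrict (contractLeft_mem ξ p)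

@[simp]
lemma contr_coe (ξ : Module.Dual R M) (p : ℕ) (x : ⋀[R]^(p + 1) M) :
    (contr ξ p x : ExteriorAlgebra R M) = CliffordAlgebra.contractLeft (Q := 0) ξ
      (x : ExteriorAlgebra R M) := rfl

lemma wedgeLeft_comp_self (ω : M) (p : ℕ) : wedgeLeft (R := R) ω (p + 1) ∘ₗ wedgeLeft ω p = 0 := by
  refine LinearMap.ext fun x => Subtype.ext ?_
  simp only [LinearMap.comp_apply, wedgeLeft_coe, LinearMap.zero_apply, ZeroMemClass.coe_zero,
    ← mul_assoc, ExteriorAlgebra.ι_sq_zero, zero_mul]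

lemma wedgeLeft_comp_add_swap (ω ω' : M) (p : ℕ) :
    wedgeLeft (R := R) ω (p + 1) ∘ₗ wedgeLeft ω' p +
      wedgeLeft ω' (p + 1) ∘ₗ wedgeLeft ω p = 0 := by
  refine LinearMap.ext fun x => Subtype.ext ?_
  simp only [LinearMap.add_apply, LinearMap.comp_apply, Submodule.coe_add, wedgeLeft_coe,
    LinearMap.zero_apply, ZeroMemClass.coe_zero, ← mul_assoc, ← add_mul,
    ExteriorAlgebra.ι_add_mul_swap, zero_mul]

lemma contr_comp_wedgeLeft_succ (ξ : Module.Dual R M) (ω : M) (p : ℕ) :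
    contr ξ (p + 1) ∘ₗ wedgeLeft ω (p + 1) + wedgeLeft ω p ∘ₗ contr ξ p =
      ξ ω • LinearMap.id := by
  refine LinearMap.ext fun x => Subtype.ext ?_
  simp only [LinearMap.add_apply, LinearMap.comp_apply, Submodule.coe_add, wedgeLeft_coe,
    contr_coe, LinearMap.smul_apply, LinearMap.id_apply, Submodule.coe_smul]
  rw [ExteriorAlgebra.ι, CliffordAlgebra.contractLeft_ι_mul]
  exact sub_add_cancel _ _

lemma contr_comp_wedgeLeft_zero (ξ : Module.Dual R M) (ω : M) :
    contr ξ 0 ∘ₗ wedgeLeft ω 0 = ξ ω • LinearMap.id := by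
  refine LinearMap.ext fun ⟨x, hx⟩ => Subtype.ext ?_
  simp only [LinearMap.comp_apply, wedgeLeft_coe,
    contr_coe, LinearMap.smul_apply, LinearMap.id_apply, Submodule.coe_smul]
  have hx' : x ∈ (1 : Submodule R (ExteriorAlgebra R M)) := by simpa using hx
  obtain ⟨r, rfl⟩ := Submodule.mem_one.1 hx'
  rw [ExteriorAlgebra.ι, CliffordAlgebra.contractLeft_ι_mul]
  rw [show (algebraMap R (ExteriorAlgebra R M)) r = algebraMap R (CliffordAlgebra 0) r from rfl,
    CliffordAlgebra.contractLeft_algebraMap, mul_zero, sub_zero]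

variable (R M) in
/-- The double dual of the `p`-th exterior power. -/
abbrev DD (p : ℕ) : Type := Module.Dual R (Module.Dual R (⋀[R]^p M))

/-- The map induced by left multiplication by `ω` on double duals of exterior powers. -/
def ddWedge (ω : M) (p : ℕ) : DD R M p →ₗ[R] DD R M (p + 1) := (wedgeLeft ω p).dualMap.dualMap

/-- The map induced by contraction with `ξ` on double duals of exterior powers. -/
def ddContr (ξ : Module.Dual R M) (p : ℕ) : DD R M (p + 1) →ₗ[R] DD R M p :=
  (contr ξ p).dualMap.dualMap

lemma ddWedge_apply (ω : M) (p : ℕ) (η : DD R M p) (ψ : Module.Dual R (⋀[R]^(p + 1) M)) :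
    ddWedge ω p η ψ = η (ψ ∘ₗ wedgeLeft ω p) := rfl

lemma ddWedge_comp_self (ω : M) (p : ℕ) : ddWedge (R := R) ω (p + 1) ∘ₗ ddWedge ω p = 0 := by
  ext η ψ
  change η (ψ ∘ₗ (wedgeLeft (R := R) ω (p + 1) ∘ₗ wedgeLeft ω p)) = 0
  simp [wedgeLeft_comp_self]

lemma ddWedge_comp_add_swap (ω ω' : M) (p : ℕ) :
    ddWedge (R := R) ω (p + 1) ∘ₗ ddWedge ω' p + ddWedge ω' (p + 1) ∘ₗ ddWedge ω p = 0 := by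
  ext η ψ
  change η (ψ ∘ₗ (wedgeLeft (R := R) ω (p + 1) ∘ₗ wedgeLeft ω' p)) +
    η (ψ ∘ₗ (wedgeLeft (R := R) ω' (p + 1) ∘ₗ wedgeLeft ω p)) = 0
  rw [← map_add, ← LinearMap.comp_add, wedgeLeft_comp_add_swap, LinearMap.comp_zero, map_zero]

lemma ddContr_comp_ddWedge_succ (ξ : Module.Dual R M) (ω : M) (p : ℕ) :
    ddContr ξ (p + 1) ∘ₗ ddWedge ω (p + 1) + ddWedge ω p ∘ₗ ddContr ξ p =
      ξ ω • LinearMap.id := by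
  ext η ψ
  change η (ψ ∘ₗ (contr ξ (p + 1) ∘ₗ wedgeLeft ω (p + 1))) +
    η (ψ ∘ₗ (wedgeLeft ω p ∘ₗ contr ξ p)) = ξ ω • η ψ
  rw [← map_add, ← LinearMap.comp_add, contr_comp_wedgeLeft_succ, LinearMap.comp_smul, map_smul,
    LinearMap.comp_id]

lemma ddContr_comp_ddWedge_zero (ξ : Module.Dual R M) (ω : M) :
    ddContr ξ 0 ∘ₗ ddWedge ω 0 = ξ ω • LinearMap.id := by
  ext η ψ
  change η (ψ ∘ₗ (contr ξ 0 ∘ₗ wedgeLeft ω 0)) = ξ ω • η ψ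
  rw [contr_comp_wedgeLeft_zero, LinearMap.comp_smul, map_smul, LinearMap.comp_id]

end Wedge

section Complex

open TensorProduct

variable {R M : Type} [CommRing R] [AddCommGroup M] [Module R M] {σ : Type} [Fintype σ]
  (A : Type) [CommRing A] [Algebra R A] (s : σ → A) (ω : σ → M)

/-- Multiplication by `∑ i, s i ⊗ ω i`. -/
def wedgeD (p : ℕ) : A ⊗[R] DD R M p →ₗ[A] A ⊗[R] DD R M (p + 1) :=
  ∑ i, s i • (ddWedge (ω i) p).baseChange A

/-- The coboundaries for `wedgeD`. -/
def wedgeB : (p : ℕ) → Submodule A (A ⊗[R] DD R M p)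
  | 0 => ⊥
  | p + 1 => LinearMap.range (wedgeD A s ω p)

lemma wedgeD_apply (p : ℕ) (x : A ⊗[R] DD R M p) :
    wedgeD A s ω p x = ∑ i, s i • (ddWedge (ω i) p).baseChange A x := by
  simp [wedgeD, LinearMap.sum_apply]

lemma wedgeD_wedgeD (p : ℕ) (x : A ⊗[R] DD R M p) :
    wedgeD A s ω (p + 1) (wedgeD A s ω p x) = 0 := by
  have h : ∀ i j, (ddWedge (ω i) (p + 1)).baseChange A ((ddWedge (ω j) p).baseChange A x) =
      - (ddWedge (ω j) (p + 1)).baseChange A ((ddWedge (ω i) p).baseChange A x) := by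
    intro i j
    rw [eq_neg_iff_add_eq_zero, ← LinearMap.comp_apply, ← LinearMap.comp_apply,
      ← LinearMap.add_apply, ← LinearMap.baseChange_comp, ← LinearMap.baseChange_comp,
      ← LinearMap.baseChange_add, ddWedge_comp_add_swap, LinearMap.baseChange_zero,
      LinearMap.zero_apply]
  have h0 : ∀ i, (ddWedge (ω i) (p + 1)).baseChange A ((ddWedge (ω i) p).baseChange A x) = 0 := by
    intro i
    rw [← LinearMap.comp_apply, ← LinearMap.baseChange_comp, ddWedge_comp_self,
      LinearMap.baseChange_zero, LinearMap.zero_apply]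
  have h2 : wedgeD A s ω (p + 1) (wedgeD A s ω p x) = ∑ y : σ × σ, (s y.1 * s y.2) •
      ((ddWedge (ω y.1) (p + 1)).baseChange A ((ddWedge (ω y.2) p).baseChange A x)) := by
    rw [Fintype.sum_prod_type]
    simp only [wedgeD_apply, map_sum, map_smul, Finset.smul_sum, smul_smul]
    rw [Finset.sum_comm]
    refine Finset.sum_congr rfl fun i _ => Finset.sum_congr rfl fun j _ => ?_
    rw [mul_comm]
  rw [h2]
  classical
  refine Finset.sum_involution (fun y _ => y.swap) ?_ ?_ ?_ ?_
  · rintro ⟨i, j⟩ _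
    simp only [Prod.swap]
    rw [h i j, mul_comm (s j), smul_neg, neg_add_cancel]
  · rintro ⟨i, j⟩ _ hne heq
    obtain rfl : j = i := congrArg Prod.fst heq
    exact hne (by rw [h0, smul_zero])
  · simp
  · simp

lemma smul_mem_wedgeB (ξ : Module.Dual R M) (p : ℕ) (x : A ⊗[R] DD R M p)
    (hx : wedgeD A s ω p x = 0) : (∑ i, algebraMap R A (ξ (ω i)) * s i) • x ∈ wedgeB A s ω p := by
  obtain _ | p := p
  · have h : (ddContr ξ 0).baseChange A (wedgeD A s ω 0 x) =
        (∑ i, algebraMap R A (ξ (ω i)) * s i) • x := by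
      rw [wedgeD_apply, map_sum, Finset.sum_smul]
      refine Finset.sum_congr rfl fun i _ => ?_
      rw [map_smul, ← LinearMap.comp_apply, ← LinearMap.baseChange_comp,
        ddContr_comp_ddWedge_zero, LinearMap.baseChange_smul, LinearMap.baseChange_id,
        LinearMap.smul_apply, LinearMap.id_apply, mul_comm, mul_smul, algebraMap_smul]
    rw [← h, hx, map_zero]
    exact Submodule.zero_mem _
  · have h : (ddContr ξ (p + 1)).baseChange A (wedgeD A s ω (p + 1) x) +
        wedgeD A s ω p ((ddContr ξ p).baseChange A x) =
        (∑ i, algebraMap R A (ξ (ω i)) * s i) • x := by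
      rw [wedgeD_apply, wedgeD_apply, map_sum, Finset.sum_smul, ← Finset.sum_add_distrib]
      refine Finset.sum_congr rfl fun i _ => ?_
      rw [map_smul, ← smul_add, ← LinearMap.comp_apply, ← LinearMap.comp_apply,
        ← LinearMap.baseChange_comp, ← LinearMap.baseChange_comp, ← LinearMap.add_apply,
        ← LinearMap.baseChange_add,
        ddContr_comp_ddWedge_succ, LinearMap.baseChange_smul, LinearMap.baseChange_id,
        LinearMap.smul_apply, LinearMap.id_apply, mul_comm, mul_smul, algebraMap_smul]
    rw [hx, map_zero, zero_add] at h
    rw [← h]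
    exact ⟨_, rfl⟩

end Complex

section Localization

open TensorProduct RingTheory.Sequence

variable {R M : Type} [CommRing R] [AddCommGroup M] [Module R M] {σ : Type} [Fintype σ]
  {A : Type} [CommRing A] [Algebra R A] {s : σ → A} {ω : σ → M}
  {A' : Type} [CommRing A'] [Algebra R A'] [Algebra A A'] [IsScalarTower R A A']

variable (A A') in
/-- The localization map of the tensor products underlying `wedgeD`. -/
def locMap (N : Type) [AddCommGroup N] [Module R N] : A ⊗[R] N →ₗ[A] A' ⊗[R] N :=
  AlgebraTensorModule.rTensor R N (Algebra.linearMap A A')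

lemma locMap_tmul {N : Type} [AddCommGroup N] [Module R N] (a : A) (x : N) :
    locMap A A' N (a ⊗ₜ[R] x) = algebraMap A A' a ⊗ₜ x := rfl

lemma locMap_smul {N : Type} [AddCommGroup N] [Module R N] (a : A) (x : A ⊗[R] N) :
    locMap A A' N (a • x) = algebraMap A A' a • locMap A A' N x := by
  rw [map_smul, algebraMap_smul]

lemma locMap_baseChange {N N' : Type} [AddCommGroup N] [Module R N] [AddCommGroup N']
    [Module R N'] (φ : N →ₗ[R] N') (x : A ⊗[R] N) :
    locMap A A' N' (φ.baseChange A x) = φ.baseChange A' (locMap A A' N x) := by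
  induction x with
  | zero => simp
  | tmul a y => simp [locMap_tmul]
  | add x y hx hy => simp [hx, hy]

lemma locMap_wedgeD (p : ℕ) (x : A ⊗[R] DD R M p) :
    locMap A A' _ (wedgeD A s ω p x) =
      wedgeD A' (fun i => algebraMap A A' (s i)) ω p (locMap A A' _ x) := by
  simp only [wedgeD_apply, map_sum, locMap_smul, locMap_baseChange]

lemma locMap_mem_wedgeB (p : ℕ) {x : A ⊗[R] DD R M p} (hx : x ∈ wedgeB A s ω p) :
    locMap A A' _ x ∈ wedgeB A' (fun i => algebraMap A A' (s i)) ω p := by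
  obtain _ | p := p
  · obtain rfl : x = 0 := hx
    rw [map_zero]
    exact Submodule.zero_mem _
  · obtain ⟨y, rfl⟩ := hx
    exact ⟨_, (locMap_wedgeD p y).symm⟩

variable (T : Submonoid A) [IsLocalization T A']

lemma exists_smul_eq_locMap {N : Type} [AddCommGroup N] [Module R N] (y : A' ⊗[R] N) :
    ∃ t ∈ T, ∃ x, algebraMap A A' t • y = locMap A A' N x := by
  have : IsLocalizedModule T (locMap (R := R) A A' N) :=
    IsLocalizedModule.rTensor A T (Algebra.linearMap A A')
  obtain ⟨⟨x, t⟩, h⟩ := IsLocalizedModule.surj T (locMap A A' N) y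
  refine ⟨t, t.2, x, ?_⟩
  rw [← h, algebraMap_smul]
  rfl

lemma exists_smul_eq_zero_of_locMap {N : Type} [AddCommGroup N] [Module R N] {x : A ⊗[R] N}
    (hx : locMap A A' N x = 0) : ∃ t ∈ T, t • x = 0 := by
  have : IsLocalizedModule T (locMap (R := R) A A' N) :=
    IsLocalizedModule.rTensor A T (Algebra.linearMap A A')
  obtain ⟨t, h⟩ := IsLocalizedModule.exists_of_eq (S := T) (f := locMap A A' N)
    (hx.trans (map_zero _).symm)
  exact ⟨t, t.2, by rwa [smul_zero] at h⟩

lemma exists_smul_mem_wedgeB (p : ℕ) {x : A ⊗[R] DD R M p}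
    (hx : locMap A A' _ x ∈ wedgeB A' (fun i => algebraMap A A' (s i)) ω p) :
    ∃ t ∈ T, t • x ∈ wedgeB A s ω p := by
  obtain _ | p := p
  · obtain ⟨t, ht, h⟩ := exists_smul_eq_zero_of_locMap T (x := x) (A' := A') hx
    exact ⟨t, ht, h⟩
  · obtain ⟨η, hη⟩ := hx
    obtain ⟨t, ht, y, hy⟩ := exists_smul_eq_locMap T η
    obtain ⟨t', ht', h⟩ := exists_smul_eq_zero_of_locMap T (A' := A')
      (x := t • x - wedgeD A s ω p y) (by
        rw [map_sub, locMap_smul, locMap_wedgeD, ← hy, map_smul, hη, sub_self])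
    refine ⟨t' * t, T.mul_mem ht' ht, t' • y, ?_⟩
    rw [smul_sub, sub_eq_zero] at h
    rw [map_smul, mul_smul, h]

lemma mem_wedgeB_of_wedgeD_eq_zero (T : Submonoid A) [IsLocalization T A'] (q : ℕ)
    (hex : ∀ x : A ⊗[R] DD R M q, wedgeD A s ω q x = 0 → x ∈ wedgeB A s ω q) (y : A' ⊗[R] DD R M q)
    (hy : wedgeD A' (fun i => algebraMap A A' (s i)) ω q y = 0) :
    y ∈ wedgeB A' (fun i => algebraMap A A' (s i)) ω q := by
  obtain ⟨t, ht, x, hx⟩ := exists_smul_eq_locMap T y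
  obtain ⟨t', ht', h⟩ := exists_smul_eq_zero_of_locMap T (A' := A') (x := wedgeD A s ω q x) (by
    rw [locMap_wedgeD, ← hx, map_smul, hy, smul_zero])
  rw [← map_smul] at h
  have h2 := locMap_mem_wedgeB (A' := A') q (hex _ h)
  rw [locMap_smul, ← hx, smul_smul] at h2
  have hu : IsUnit (algebraMap A A' t' * algebraMap A A' t) :=
    (IsLocalization.map_units A' ⟨t', ht'⟩).mul (IsLocalization.map_units A' ⟨t, ht⟩)
  exact (Submodule.smul_mem_iff_of_isUnit _ hu).1 h2

/-- If the complex given by `wedgeD` is exact below degree `p` and its terms up to degree `p` have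
projective dimension at most their degree, then a prime annihilator of a class modulo coboundaries
in degree `p` contains, locally, no weakly regular sequence of length `p + 1`. -/
lemma false_of_isWeaklyRegular [Module.Flat R A'] (p : ℕ)
    (hex : ∀ q < p, ∀ x : A ⊗[R] DD R M q, wedgeD A s ω q x = 0 → x ∈ wedgeB A s ω q)
    (hpd : ∀ q ≤ p, ProjDimLE R q (ModuleCat.of R (DD R M q)))
    (P : Ideal A) (hT : ∀ t ∈ T, t ∉ P) (h : A ⊗[R] DD R M p)
    (hP : ∀ a, a ∈ P ↔ a • h ∈ wedgeB A s ω p)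
    (rs : List A') (hrsP : ∀ a ∈ rs, a ∈ P.map (algebraMap A A')) (hrs : IsWeaklyRegular A' rs)
    (hlen : p < rs.length) : False := by
  let I := P.map (algebraMap A A')
  have hI : ∀ a ∈ I, a • locMap A A' _ h ∈ wedgeB A' (fun i => algebraMap A A' (s i)) ω p := by
    intro a ha
    induction ha using Submodule.span_induction with
    | mem a ha =>
      obtain ⟨b, hb, rfl⟩ := ha
      rw [← locMap_smul]
      exact locMap_mem_wedgeB p ((hP b).1 hb)
    | zero => rw [zero_smul]; exact Submodule.zero_mem _
    | add a b _ _ ha hb => rw [add_smul]; exact Submodule.add_mem _ ha hb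
    | smul c a _ ha => rw [smul_assoc]; exact Submodule.smul_mem _ _ ha
  have key := mem_of_forall_smul_mem I (fun q => A' ⊗[R] DD R M q)
    (wedgeD A' (fun i => algebraMap A A' (s i)) ω) (wedgeB A' (fun i => algebraMap A A' (s i)) ω)
    rfl (fun q => rfl) p (fun q hq => le_antisymm
      (fun y hy => mem_wedgeB_of_wedgeD_eq_zero T q (hex q hq) y hy) ?_)
      (fun q i hiq => subsingleton_ext_of_projDimLE _ rs ?_ hrs q _ (hpd q (by omega)) i
        (by omega)) (locMap A A' _ h) hI
  · obtain ⟨t, ht, h2⟩ := exists_smul_mem_wedgeB T p key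
    exact hT t ht ((hP t).2 h2)
  · obtain _ | q := q
    · exact bot_le
    · rintro _ ⟨y, rfl⟩
      exact wedgeD_wedgeD _ _ _ _ _
  · intro a ha x
    obtain ⟨b, rfl⟩ := Ideal.Quotient.mk_surjective x
    change Ideal.Quotient.mk I (a * b) = 0
    exact Ideal.Quotient.eq_zero_iff_mem.2 (I.mul_mem_right _ (hrsP a ha))

/-- The annihilator of a class is contained in a prime annihilator. -/
lemma exists_isPrime_annihilator [IsNoetherianRing A] (p : ℕ) (h : A ⊗[R] DD R M p)
    (hh : h ∉ wedgeB A s ω p) : ∃ (P : Ideal A) (h' : A ⊗[R] DD R M p), P.IsPrime ∧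
      (∀ a, a ∈ P ↔ a • h' ∈ wedgeB A s ω p) ∧ ∀ a, a • h ∈ wedgeB A s ω p → a ∈ P := by
  have h0 : (wedgeB A s ω p).mkQ h ≠ 0 := fun h1 =>
    hh ((Submodule.Quotient.mk_eq_zero _).1 h1)
  obtain ⟨P, h2, hle⟩ := exists_le_isAssociatedPrime_of_isNoetherianRing A _ h0
  obtain ⟨hP, y, rfl⟩ := isAssociatedPrime_iff.1 h2
  obtain ⟨x, rfl⟩ := (wedgeB A s ω p).mkQ_surjective y
  have key : ∀ (a : A) (z : A ⊗[R] DD R M p),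
      a ∈ (⊥ : Submodule A _).colon {(wedgeB A s ω p).mkQ z} ↔ a • z ∈ wedgeB A s ω p := by
    intro a z
    rw [Submodule.mem_colon_singleton, ← map_smul, Submodule.mem_bot, Submodule.mkQ_apply,
      Submodule.Quotient.mk_eq_zero]
  exact ⟨_, x, hP, fun a => key a x, fun a ha => hle ((key a h).2 ha)⟩

end Localization

section Divisibility

variable {R N : Type} [CommRing R] [IsDomain R] [AddCommGroup N] [Module R N]

/-- A linear map all of whose values are divisible by `c ≠ 0` is a multiple of `c`. -/
lemma LinearMap.exists_smul_eq_of_dvd {c : R} (hc : c ≠ 0) (g : N →ₗ[R] R) (h : ∀ x, c ∣ g x) :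
    ∃ g' : N →ₗ[R] R, c • g' = g := by
  choose g' hg' using h
  refine ⟨⟨⟨g', fun x y => mul_left_cancel₀ hc ?_⟩, fun a x => mul_left_cancel₀ hc ?_⟩, ?_⟩
  · rw [← hg', map_add, mul_add, ← hg', ← hg']
  · rw [← hg', map_smul, hg', smul_eq_mul, smul_eq_mul, RingHom.id_apply, mul_left_comm]
  · ext x
    exact (hg' x).symm

end Divisibility

lemma Derivation.apply_linForm (θ : Derivation ℂ (PolyR n) (PolyR n)) (v : Fin n → ℂ) :
    θ (linForm v) = ∑ j, C (v j) * θ (X j) := by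
  rw [linForm_apply, map_sum]
  exact Finset.sum_congr rfl fun j _ => by rw [map_smul, smul_eq_C_mul]

lemma pderiv_linForm (v : Fin n → ℂ) (j : Fin n) : pderiv j (linForm v) = C (v j) := by
  classical
  simp [Derivation.apply_linForm, pderiv_X, Pi.single_apply]

lemma mkDerivation_linForm (b : Fin n → PolyR n) (v : Fin n → ℂ) :
    mkDerivation ℂ b (linForm v) = ∑ j, C (v j) * b j := by
  simp only [Derivation.apply_linForm, mkDerivation_X]

section Arrangement

variable {f : ι → PolyR n}

/-- A derivation preserves the arrangement if and only if it preserves every hyperplane. -/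
lemma mem_DerA_iff (hp : ∀ i, Prime (f i)) (hc : Pairwise fun i j => IsRelPrime (f i) (f j))
    {θ : Derivation ℂ (PolyR n) (PolyR n)} : θ ∈ DerA f ↔ ∀ i, f i ∣ θ (f i) := by
  classical
  change θ (∏ i, f i) ∈ Ideal.span {∏ i, f i} ↔ _
  rw [Ideal.mem_span_singleton]
  constructor
  · intro h i
    have h1 : f i ∣ θ (f i * ∏ j ∈ Finset.univ.erase i, f j) := by
      rw [Finset.mul_prod_erase _ _ (Finset.mem_univ i)]
      exact (Finset.dvd_prod_of_mem f (Finset.mem_univ i)).trans h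
    rw [Derivation.leibniz, smul_eq_mul, smul_eq_mul, dvd_add_right (dvd_mul_right _ _)] at h1
    refine ((hp i).dvd_or_dvd h1).resolve_left fun h2 => ?_
    obtain ⟨j, hj, h3⟩ := (hp i).exists_mem_finset_dvd h2
    exact (hp i).not_isUnit (hc (Finset.ne_of_mem_erase hj).symm dvd_rfl h3)
  · intro h
    suffices H : ∀ s : Finset ι, ∏ i ∈ s, f i ∣ θ (∏ i ∈ s, f i) from H _
    intro s
    induction s using Finset.induction_on with
    | empty => simp
    | insert i s hi ih =>
      rw [Finset.prod_insert hi, Derivation.leibniz, smul_eq_mul, smul_eq_mul]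
      refine dvd_add (mul_dvd_mul_left _ ih) ?_
      rw [mul_comm (f i)]
      exact mul_dvd_mul_left _ (h i)

/-- The logarithmic form `θ ↦ θ(g)`, the differential of `g`. -/
def evalDer (f : ι → PolyR n) (g : PolyR n) : OmegaOne f where
  toFun θ := (θ : Derivation ℂ (PolyR n) (PolyR n)) g
  map_add' _ _ := rfl
  map_smul' _ _ := rfl

@[simp]
lemma evalDer_apply (g : PolyR n) (θ : DerA f) :
    evalDer f g θ = (θ : Derivation ℂ (PolyR n) (PolyR n)) g := rfl

lemma evalDer_linForm (v : Fin n → ℂ) :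
    evalDer f (linForm v) = ∑ j, (C (v j) : PolyR n) • evalDer f (X j) := by
  ext θ
  simp only [evalDer_apply, Derivation.apply_linForm, LinearMap.sum_apply, LinearMap.smul_apply,
    smul_eq_mul]

/-- There are logarithmic forms `ω_i = df_i / f_i`. -/
lemma exists_dlog (hp : ∀ i, Prime (f i)) (hc : Pairwise fun i j => IsRelPrime (f i) (f j)) :
    ∃ ω : ι → OmegaOne f, ∀ i, f i • ω i = evalDer f (f i) := by
  choose ω hω using fun i => LinearMap.exists_smul_eq_of_dvd (hp i).ne_zero (evalDer f (f i))
    fun θ : DerA f => (mem_DerA_iff hp hc).1 θ.2 i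
  exact ⟨ω, hω⟩

lemma mem_logDer_iff (hp : ∀ i, Prime (f i)) (hc : Pairwise fun i j => IsRelPrime (f i) (f j))
    {φ : ι → Fin n → ℂ} (hf : ∀ i, f i = linForm (φ i)) {ω : ι → OmegaOne f}
    (hω : ∀ i, f i • ω i = evalDer f (f i)) {a : ι → PolyR n} :
    a ∈ logDer f ↔ ∃ θ : DerA f, ∀ i, a i = -ω i θ := by
  have hb : ∀ (b : Fin n → PolyR n) i, mkDerivation ℂ b (f i) = ∑ j, b j * pderiv j (f i) := by
    intro b i
    rw [hf, mkDerivation_linForm]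
    exact Finset.sum_congr rfl fun j _ => by rw [pderiv_linForm, mul_comm]
  constructor
  · rintro ⟨b, h⟩
    have h1 : ∀ i, mkDerivation ℂ b (f i) = f i * -a i := fun i => by
      rw [hb]
      linear_combination h i
    refine ⟨⟨mkDerivation ℂ b, (mem_DerA_iff hp hc).2 fun i => ⟨_, h1 i⟩⟩, fun i => ?_⟩
    have h2 := LinearMap.congr_fun (hω i)
      ⟨mkDerivation ℂ b, (mem_DerA_iff hp hc).2 fun i => ⟨_, h1 i⟩⟩
    rw [LinearMap.smul_apply, evalDer_apply, h1] at h2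
    rw [mul_left_cancel₀ (hp i).ne_zero h2, neg_neg]
  · rintro ⟨⟨θ, hθ⟩, h⟩
    refine ⟨fun j => θ (X j), fun i => ?_⟩
    rw [← hb, h]
    have h1 : mkDerivation ℂ (fun j => θ (X j)) = θ :=
      MvPolynomial.derivation_ext fun j => mkDerivation_X _ _ _
    rw [h1]
    have h2 := LinearMap.congr_fun (hω i) ⟨θ, hθ⟩
    rw [LinearMap.smul_apply, evalDer_apply, smul_eq_mul] at h2
    rw [← h2]
    ring

/-- A functional on `Ω¹(A)` gives an element of the log-derivation module. -/
lemma neg_apply_mem_logDer {φ : ι → Fin n → ℂ} (hf : ∀ i, f i = linForm (φ i))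
    {ω : ι → OmegaOne f} (hω : ∀ i, f i • ω i = evalDer f (f i))
    (ξ : Module.Dual (PolyR n) (OmegaOne f)) : (fun i => -ξ (ω i)) ∈ logDer f := by
  refine ⟨fun j => ξ (evalDer f (X j)), fun i => ?_⟩
  have h : f i * ξ (ω i) = ∑ j, ξ (evalDer f (X j)) * pderiv j (f i) := by
    rw [← smul_eq_mul, ← map_smul, hω]
    conv_lhs => rw [hf, evalDer_linForm, map_sum]
    refine Finset.sum_congr rfl fun j _ => ?_
    rw [map_smul, smul_eq_mul, mul_comm, hf, pderiv_linForm]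
  rw [← h]
  ring

end Arrangement

section LinearAlgebra

lemma Module.Basis.sumExtend_inl {K V κ : Type*} [DivisionRing K] [AddCommGroup V] [Module K V]
    {v : κ → V} (hv : LinearIndependent K v) (k : κ) :
    Module.Basis.sumExtend hv (Sum.inl k) = v k := by
  simp only [Module.Basis.sumExtend, Module.Basis.reindex_apply, Module.Basis.coe_extend]
  rfl

/-- Bases of a family of vectors adapted to a subfamily, with dual vectors. -/
lemma exists_adapted_basis (φ : ι → Fin n → ℂ) (Z : Set ι) :
    ∃ (I₁ I₂ : Finset ι) (v : ι → Fin n → ℂ), ↑I₁ ⊆ Z ∧ I₁ ⊆ I₂ ∧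
      LinearIndepOn ℂ φ (I₂ : Set ι) ∧
      I₂.card = Module.finrank ℂ (Submodule.span ℂ (Set.range φ)) ∧
      (∀ i ∈ I₂, φ i ⬝ᵥ v i = 1) ∧ (∀ i ∈ I₂, ∀ j ∈ I₂, i ≠ j → φ j ⬝ᵥ v i = 0) ∧
      (∀ i ∈ I₂, i ∉ I₁ → ∀ j ∈ Z, φ j ⬝ᵥ v i = 0) ∧
      (∀ j ∈ Z, φ j = ∑ i ∈ I₁, (φ j ⬝ᵥ v i) • φ i) ∧
      ∀ j, φ j = ∑ i ∈ I₂, (φ j ⬝ᵥ v i) • φ i := by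
  classical
  have h0 : LinearIndepOn ℂ φ (∅ : Set ι) := linearIndepOn_empty _ _
  set J₁ := h0.extend (Set.empty_subset Z)
  have hJ₁ : LinearIndepOn ℂ φ J₁ := h0.linearIndepOn_extend _
  have hs₁ : φ '' Z ⊆ Submodule.span ℂ (φ '' J₁) := h0.image_subset_span_image_extend _
  have hJ₁Z : J₁ ⊆ Z := h0.extend_subset _
  clear_value J₁
  set J₂ := hJ₁.extend (Set.subset_univ J₁)
  have hJ₂ : LinearIndepOn ℂ φ J₂ := hJ₁.linearIndepOn_extend _
  have hs₂ : φ '' Set.univ ⊆ Submodule.span ℂ (φ '' J₂) := hJ₁.image_subset_span_image_extend _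
  have hJ₁₂ : J₁ ⊆ J₂ := hJ₁.subset_extend _
  clear_value J₂
  let b := Module.Basis.sumExtend hJ₂
  have hbi : ∀ i (hi : i ∈ J₂), b (Sum.inl ⟨i, hi⟩) = φ i := fun i hi =>
    Module.Basis.sumExtend_inl hJ₂ _
  let v : ι → Fin n → ℂ := fun i j =>
    if hi : i ∈ J₂ then b.coord (Sum.inl ⟨i, hi⟩) (Pi.single j 1) else 0
  have hv : ∀ i (hi : i ∈ J₂) (w : Fin n → ℂ), w ⬝ᵥ v i = b.coord (Sum.inl ⟨i, hi⟩) w := by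
    intro i hi w
    conv_rhs => rw [pi_eq_sum_univ' w]
    simp only [dotProduct, v, dif_pos hi, map_sum, map_smul, smul_eq_mul]
  have h1 : ∀ i ∈ J₂, φ i ⬝ᵥ v i = 1 := fun i hi => by
    rw [hv i hi, ← hbi i hi]
    simp
  have h2 : ∀ i ∈ J₂, ∀ j ∈ J₂, i ≠ j → φ j ⬝ᵥ v i = 0 := fun i hi j hj hij => by
    rw [hv i hi, ← hbi j hj, Module.Basis.coord_apply, Module.Basis.repr_self,
      Finsupp.single_eq_of_ne]
    simpa using hij
  have h3 : ∀ (J : Set ι), J ⊆ J₂ → ∀ w ∈ Submodule.span ℂ (φ '' J),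
      (∀ i ∈ J₂, i ∉ J → w ⬝ᵥ v i = 0) ∧ w = ∑ i ∈ J.toFinset, (w ⬝ᵥ v i) • φ i := by
    intro J hJ w hw
    induction hw using Submodule.span_induction with
    | mem w hw =>
      obtain ⟨j, hj, rfl⟩ := hw
      refine ⟨fun i hi hij => h2 i hi j (hJ hj) fun h => hij (h ▸ hj), ?_⟩
      rw [Finset.sum_eq_single j, h1 j (hJ hj), one_smul]
      · intro i hi hij
        rw [h2 i (hJ (Set.mem_toFinset.1 hi)) j (hJ hj) hij, zero_smul]
      · exact fun h => absurd (Set.mem_toFinset.2 hj) h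
    | zero => simp
    | add x y _ _ hx hy =>
      refine ⟨fun i hi hij => by rw [add_dotProduct, hx.1 i hi hij, hy.1 i hi hij, add_zero], ?_⟩
      simp only [add_dotProduct, add_smul, Finset.sum_add_distrib]
      rw [← hx.2, ← hy.2]
    | smul a x _ hx =>
      refine ⟨fun i hi hij => by rw [smul_dotProduct, hx.1 i hi hij, smul_zero], ?_⟩
      simp only [smul_dotProduct, smul_eq_mul, mul_smul, ← Finset.smul_sum]
      rw [← hx.2]
  have hspan : Submodule.span ℂ (Set.range φ) = Submodule.span ℂ (φ '' J₂) :=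
    le_antisymm (Submodule.span_le.2 (by rwa [Set.image_univ] at hs₂))
      (Submodule.span_mono (Set.image_subset_range _ _))
  refine ⟨J₁.toFinset, J₂.toFinset, v, by simpa using hJ₁Z, by simpa using hJ₁₂, by simpa using hJ₂,
    ?_, by simpa using h1, by simpa using h2, ?_, ?_, ?_⟩
  · rw [hspan, Set.image_eq_range, finrank_span_eq_card hJ₂, Set.toFinset_card]
  · intro i hi hi₁ j hj
    exact (h3 J₁ hJ₁₂ _ (hs₁ ⟨j, hj, rfl⟩)).1 i (by simpa using hi) (by simpa using hi₁)
  · intro j hj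
    exact (h3 J₁ hJ₁₂ _ (hs₁ ⟨j, hj, rfl⟩)).2
  · intro j
    exact (h3 J₂ subset_rfl _ (hs₂ ⟨j, trivial, rfl⟩)).2

open RingTheory.Sequence in
lemma isWeaklyRegular_linForm_of_linearIndepOn {φ : ι → Fin n → ℂ} {I : Finset ι}
    (h : LinearIndepOn ℂ φ (I : Set ι)) :
    IsWeaklyRegular (PolyR n) (I.toList.map fun i => linForm (φ i)) := by
  classical
  let b := Module.Basis.sumExtend h
  have hbi : ∀ i : I, b (Sum.inl i) = φ i := fun i => Module.Basis.sumExtend_inl h _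
  convert isWeaklyRegular_map_linForm b (I.toList.attach.map fun i =>
    Sum.inl ⟨i.1, Finset.mem_toList.1 i.2⟩) ?_ using 1
  · rw [List.map_map]
    conv_lhs => rw [← List.attach_map_subtype_val I.toList, List.map_map]
    refine List.map_congr_left fun i _ => ?_
    simp only [Function.comp_apply]
    exact congrArg linForm (hbi ⟨i.1, Finset.mem_toList.1 i.2⟩).symm
  · refine List.Nodup.map ?_ (List.nodup_attach.2 I.nodup_toList)
    intro i j hij
    simpa [Subtype.ext_iff] using hij

end LinearAlgebra

section Exactness

open TensorProduct

variable {f : ι → PolyR n}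

/-- A prime containing the symbols of all logarithmic derivations contains, locally, long weakly
regular sequences. -/
lemma exists_isWeaklyRegular_list (hp : ∀ i, Prime (f i))
    (hc : Pairwise fun i j => IsRelPrime (f i) (f j))
    {φ : ι → Fin n → ℂ} (hf : ∀ i, f i = linForm (φ i)) {ω : ι → OmegaOne f}
    (hω : ∀ i, f i • ω i = evalDer f (f i)) (P : Ideal (MvPolynomial ι (PolyR n))) [P.IsPrime]
    (hL : ∀ θ, ∑ i, C (ω i θ) * X i ∈ P) (D : Type) [CommRing D] [Algebra (PolyR n) D]
    [IsLocalization (P.comap C).primeCompl D] :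
    ∃ rs : List (MvPolynomial ι D),
      (∀ a ∈ rs, a ∈ P.map (MvPolynomial.map (algebraMap (PolyR n) D))) ∧
      RingTheory.Sequence.IsWeaklyRegular (MvPolynomial ι D) rs ∧
      Module.finrank ℂ (Submodule.span ℂ (Set.range φ)) ≤ rs.length ∧
      ((∃ i, C (f i) ∈ P) → Module.finrank ℂ (Submodule.span ℂ (Set.range φ)) < rs.length) := by
  classical
  obtain ⟨I₁, I₂, v, h₁, h₁₂, hli, hcard, hv1, hv0, hvZ, hZ, -⟩ :=
    exists_adapted_basis φ {i | C (f i) ∈ P}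
  set P' := P.map (MvPolynomial.map (algebraMap (PolyR n) D)) with hP'
  set α := algebraMap (PolyR n) D with hα
  have hle : (P.comap C).primeCompl ≤ nonZeroDivisors (PolyR n) :=
    Ideal.primeCompl_le_nonZeroDivisors _
  have hinj : Function.Injective α := IsLocalization.injective D hle
  have : IsDomain D := IsLocalization.isDomain_of_le_nonZeroDivisors D hle
  have hunit : ∀ g, C g ∉ P → IsUnit (α g) := fun g hg =>
    IsLocalization.map_units D (⟨g, hg⟩ : (P.comap C).primeCompl)
  have hα0 : ∀ i, α (f i) ≠ 0 := fun i h => (hp i).ne_zero (hinj (h.trans (map_zero α).symm))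
  -- symbols of derivations defined locally
  have hmem : ∀ (b : Fin n → PolyR n) (a : ι → D),
      (∀ i, a i * α (f i) = α (∑ j, C (φ i j) * b j)) →
      (∀ i, C (f i) ∈ P → f i ∣ ∑ j, C (φ i j) * b j) → ∑ i, C (a i) * X i ∈ P' := by
    intro b a ha hb
    set g := ∏ i ∈ Finset.univ.filter fun i => C (f i) ∉ P, f i with hg
    have hgP : C g ∉ P := by
      rw [hg, map_prod, Ideal.IsPrime.prod_mem_iff]
      rintro ⟨i, hi, hi'⟩
      exact (Finset.mem_filter.1 hi).2 hi'
    have hgf : ∀ i, mkDerivation ℂ (fun j => g * b j) (f i) = g * ∑ j, C (φ i j) * b j := by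
      intro i
      rw [hf, mkDerivation_linForm, Finset.mul_sum]
      exact Finset.sum_congr rfl fun j _ => mul_left_comm _ _ _
    have hθ : mkDerivation ℂ (fun j => g * b j) ∈ DerA f := by
      rw [mem_DerA_iff hp hc]
      intro i
      rw [hgf]
      by_cases hi : C (f i) ∈ P
      · exact (hb i hi).mul_left _
      · exact (Finset.dvd_prod_of_mem f
          (Finset.mem_filter.2 ⟨Finset.mem_univ i, hi⟩)).mul_right _
    have h1 := Ideal.mem_map_of_mem (MvPolynomial.map α) (hL ⟨_, hθ⟩)
    have h2 : MvPolynomial.map α (∑ i, C (ω i ⟨_, hθ⟩) * X i) =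
        C (α g) * ∑ i, C (a i) * X i := by
      rw [map_sum, Finset.mul_sum]
      refine Finset.sum_congr rfl fun i _ => ?_
      rw [map_mul, MvPolynomial.map_C, MvPolynomial.map_X, ← mul_assoc, ← map_mul]
      congr 2
      refine mul_right_cancel₀ (hα0 i) ?_
      have h3 := LinearMap.congr_fun (hω i) ⟨_, hθ⟩
      rw [LinearMap.smul_apply, evalDer_apply, hgf, smul_eq_mul] at h3
      rw [mul_assoc, ha, ← map_mul, ← map_mul, ← h3, mul_comm]
    rw [h2] at h1
    exact (Ideal.unit_mul_mem_iff_mem _ ((hunit g hgP).map C)).1 h1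
  have hsum : ∀ i ρ, ∑ j, C (φ ρ j) * (f i * C (v i j)) = f i * C (φ ρ ⬝ᵥ v i) := by
    intro i ρ
    rw [dotProduct, map_sum, Finset.mul_sum]
    refine Finset.sum_congr rfl fun j _ => ?_
    rw [map_mul]
    ring
  have hfZ : ∀ ρ, C (f ρ) ∈ P → ∑ i ∈ I₁, f i * C (φ ρ ⬝ᵥ v i) = f ρ := by
    intro ρ hρ
    conv_rhs => rw [hf, hZ ρ hρ, map_sum]
    refine Finset.sum_congr rfl fun i _ => ?_
    rw [map_smul, ← hf, smul_eq_C_mul, mul_comm]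
  have hI : ∀ i ∈ I₂, i ∉ I₁ → C (f i) ∉ P := fun i hi hi' h =>
    one_ne_zero ((hv1 i hi).symm.trans (hvZ i hi hi' i h))
  -- the linear forms of the sequence
  let c₁ : ι → ι → D := fun i ρ => α (f i * C (φ ρ ⬝ᵥ v i)) * Ring.inverse (α (f ρ))
  let c₀ : ι → D := fun ρ => if C (f ρ) ∈ P then 1 else
    α (∑ i ∈ I₁, f i * C (φ ρ ⬝ᵥ v i)) * Ring.inverse (α (f ρ))
  have hc₁ : ∀ i ∈ I₂, i ∉ I₁ → ∑ ρ, C (c₁ i ρ) * X ρ ∈ P' := by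
    intro i hi hi'
    refine hmem (fun j => f i * C (v i j)) _ (fun ρ => ?_) fun ρ hρ => ?_
    · rw [hsum]
      by_cases hρ : C (f ρ) ∈ P
      · simp [c₁, hvZ i hi hi' ρ hρ]
      · simp only [c₁]
        rw [mul_assoc, Ring.inverse_mul_cancel _ (hunit _ hρ), mul_one]
    · rw [hsum, hvZ i hi hi' ρ hρ, map_zero, mul_zero]
      exact dvd_zero _
  have hc₀ : ∑ ρ, C (c₀ ρ) * X ρ ∈ P' := by
    have hs : ∀ ρ, ∑ j, C (φ ρ j) * ∑ i ∈ I₁, f i * C (v i j) =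
        ∑ i ∈ I₁, f i * C (φ ρ ⬝ᵥ v i) := by
      intro ρ
      simp only [Finset.mul_sum]
      rw [Finset.sum_comm]
      exact Finset.sum_congr rfl fun i _ => hsum i ρ
    refine hmem (fun j => ∑ i ∈ I₁, f i * C (v i j)) _ (fun ρ => ?_) fun ρ hρ => ?_
    · rw [hs]
      by_cases hρ : C (f ρ) ∈ P
      · simp [c₀, hρ, hfZ ρ hρ]
      · simp only [c₀, if_neg hρ]
        rw [mul_assoc, Ring.inverse_mul_cancel _ (hunit _ hρ), mul_one]
    · rw [hs, hfZ ρ hρ]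
  let c : ι → ι → D := fun i => if i ∈ I₁ then c₀ else c₁ i
  have hy := (isWeaklyRegular_linForm_of_linearIndepOn (hli.mono
    (Finset.coe_subset.2 h₁₂))).of_isLocalization D (P.comap C).primeCompl
  have main : ∀ Θ : Finset ι, I₂ \ I₁ ⊆ Θ → Θ ⊆ I₂ → (∀ i ∈ I₁, ∀ j ∈ I₁, i ∈ Θ → j ∈ Θ → i = j) →
      ∃ rs : List (MvPolynomial ι D), (∀ a ∈ rs, a ∈ P') ∧
        RingTheory.Sequence.IsWeaklyRegular (MvPolynomial ι D) rs ∧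
        rs.length = I₁.card + Θ.card := by
    intro Θ hΘ₁ hΘ₂ hΘ
    refine ⟨_, ?_, isWeaklyRegular_map_C_append_map_linear hy Θ.toList Θ.nodup_toList c ?_ ?_, ?_⟩
    · intro a ha
      rw [List.mem_append] at ha
      obtain ha | ha := ha
      · simp only [List.map_map, List.mem_map, Finset.mem_toList, Function.comp_apply] at ha
        obtain ⟨i, hi, rfl⟩ := ha
        have := Ideal.mem_map_of_mem (MvPolynomial.map α) (h₁ hi)
        rwa [MvPolynomial.map_C, hf] at this
      · simp only [List.mem_map, Finset.mem_toList] at ha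
        obtain ⟨i, hi, rfl⟩ := ha
        by_cases hi₁ : i ∈ I₁
        · simpa only [c, if_pos hi₁] using hc₀
        · simpa only [c, if_neg hi₁] using hc₁ i (hΘ₂ hi) hi₁
    · intro i hi ρ hρ hne
      rw [Finset.mem_toList] at hi hρ
      by_cases hi₁ : i ∈ I₁
      · have hρ₁ : ρ ∉ I₁ := fun h => hne (hΘ ρ h i hi₁ hρ hi)
        simp only [c, if_pos hi₁, c₀, if_neg (hI ρ (hΘ₂ hρ) hρ₁)]
        rw [Finset.sum_eq_zero, map_zero, zero_mul]
        intro τ hτ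
        rw [hv0 τ (h₁₂ hτ) ρ (hΘ₂ hρ) fun h => hρ₁ (h ▸ hτ), map_zero, mul_zero]
      · simp only [c, if_neg hi₁, c₁]
        rw [hv0 i (hΘ₂ hi) ρ (hΘ₂ hρ) hne.symm, map_zero, mul_zero, map_zero, zero_mul]
    · intro i hi
      rw [Finset.mem_toList] at hi
      by_cases hi₁ : i ∈ I₁
      · have : C (f i) ∈ P := h₁ hi₁
        simp only [c, if_pos hi₁, c₀, if_pos this]
      · simp only [c, if_neg hi₁, c₁]
        rw [hv1 i (hΘ₂ hi), map_one, mul_one,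
          Ring.mul_inverse_cancel _ (hunit _ (hI i (hΘ₂ hi) hi₁))]
    · simp
  have hcard' : I₁.card + (I₂ \ I₁).card = I₂.card := by
    rw [add_comm, Finset.card_sdiff_add_card_eq_card h₁₂]
  by_cases hZ' : ∃ i, C (f i) ∈ P
  · obtain ⟨i₀, hi₀⟩ := hZ'
    obtain ⟨i₁, hi₁⟩ : I₁.Nonempty := by
      rw [Finset.nonempty_iff_ne_empty]
      rintro rfl
      exact (hp i₀).ne_zero (by rw [← hfZ i₀ hi₀, Finset.sum_empty])
    obtain ⟨rs, hrs₁, hrs₂, hrs₃⟩ := main (insert i₁ (I₂ \ I₁)) (Finset.subset_insert _ _)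
      (Finset.insert_subset (h₁₂ hi₁) Finset.sdiff_subset) (by
        intro i hi j hj hi' hj'
        simp only [Finset.mem_insert, Finset.mem_sdiff, hi, hj, not_true_eq_false, and_false,
          or_false] at hi' hj'
        rw [hi', hj'])
    rw [Finset.card_insert_of_notMem (by simp [hi₁])] at hrs₃
    exact ⟨rs, hrs₁, hrs₂, by omega, fun _ => by omega⟩
  · obtain ⟨rs, hrs₁, hrs₂, hrs₃⟩ := main (I₂ \ I₁) subset_rfl Finset.sdiff_subset (by
      intro i hi j hj hi' hj'
      simp [hi] at hi')
    exact ⟨rs, hrs₁, hrs₂, by omega, fun h => absurd h hZ'⟩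

attribute [local instance] MvPolynomial.algebraMvPolynomial in
/-- A prime annihilating a class modulo coboundaries, and containing the symbols of all logarithmic
derivations, contains no hyperplane and can only occur from degree `finrank (span φ)` on. -/
lemma finrank_le_of_annihilator (hp : ∀ i, Prime (f i))
    (hc : Pairwise fun i j => IsRelPrime (f i) (f j))
    {φ : ι → Fin n → ℂ} (hf : ∀ i, f i = linForm (φ i)) {ω : ι → OmegaOne f}
    (hω : ∀ i, f i • ω i = evalDer f (f i)) (p : ℕ)
    (hex : ∀ q < p, ∀ x : MvPolynomial ι (PolyR n) ⊗[PolyR n] OmegaP f q,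
      wedgeD (MvPolynomial ι (PolyR n)) X ω q x = 0 →
      x ∈ wedgeB (MvPolynomial ι (PolyR n)) X ω q)
    (hpd : ∀ q ≤ p, ProjDimLE (PolyR n) q (ModuleCat.of (PolyR n) (OmegaP f q)))
    (P : Ideal (MvPolynomial ι (PolyR n))) [P.IsPrime]
    (h : MvPolynomial ι (PolyR n) ⊗[PolyR n] OmegaP f p)
    (hP : ∀ a, a ∈ P ↔ a • h ∈ wedgeB (MvPolynomial ι (PolyR n)) X ω p)
    (hL : ∀ θ, ∑ i, C (ω i θ) * X i ∈ P)
    (D : Type) [CommRing D] [Algebra (PolyR n) D] [IsLocalization (P.comap C).primeCompl D] :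
    Module.finrank ℂ (Submodule.span ℂ (Set.range φ)) ≤ p ∧
      ((∃ i, C (f i) ∈ P) → Module.finrank ℂ (Submodule.span ℂ (Set.range φ)) < p) := by
  obtain ⟨rs, hrsP, hrs, hlen₁, hlen₂⟩ := exists_isWeaklyRegular_list hp hc hf hω P hL D
  have : Module.Flat (PolyR n) D := IsLocalization.flat D (P.comap C).primeCompl
  have : Module.Flat (PolyR n) (MvPolynomial ι D) := Module.Flat.trans (PolyR n) D _
  have hlen : rs.length ≤ p := by
    by_contra! hlen
    refine false_of_isWeaklyRegular (A' := MvPolynomial ι D) ((P.comap C).primeCompl.map C) p hex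
      hpd P ?_ h hP rs hrsP hrs hlen
    rintro _ ⟨g, hg, rfl⟩
    exact hg
  exact ⟨hlen₁.trans hlen, fun h => (hlen₂ h).trans_le hlen⟩

lemma mem_wedgeB_of_lt_or_smul_mem (hp : ∀ i, Prime (f i))
    (hc : Pairwise fun i j => IsRelPrime (f i) (f j))
    {φ : ι → Fin n → ℂ} (hf : ∀ i, f i = linForm (φ i)) {ω : ι → OmegaOne f}
    (hω : ∀ i, f i • ω i = evalDer f (f i)) (p : ℕ)
    (hpr : p ≤ Module.finrank ℂ (Submodule.span ℂ (Set.range φ)))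
    (hex : ∀ q < p, ∀ x : MvPolynomial ι (PolyR n) ⊗[PolyR n] OmegaP f q,
      wedgeD (MvPolynomial ι (PolyR n)) X ω q x = 0 →
      x ∈ wedgeB (MvPolynomial ι (PolyR n)) X ω q)
    (hpd : ∀ q ≤ p, ProjDimLE (PolyR n) q (ModuleCat.of (PolyR n) (OmegaP f q)))
    (x : MvPolynomial ι (PolyR n) ⊗[PolyR n] OmegaP f p)
    (hx : wedgeD (MvPolynomial ι (PolyR n)) X ω p x = 0)
    (h : p < Module.finrank ℂ (Submodule.span ℂ (Set.range φ)) ∨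
      (C (∏ i, f i) : MvPolynomial ι (PolyR n)) • x ∈
        wedgeB (MvPolynomial ι (PolyR n)) X ω p) :
    x ∈ wedgeB (MvPolynomial ι (PolyR n)) X ω p := by
  by_contra hxB
  obtain ⟨P, h', hPp, hP, hPx⟩ : ∃ (P : Ideal (MvPolynomial ι (PolyR n)))
      (h' : MvPolynomial ι (PolyR n) ⊗[PolyR n] OmegaP f p), P.IsPrime ∧
      (∀ a, a ∈ P ↔ a • h' ∈ wedgeB (MvPolynomial ι (PolyR n)) X ω p) ∧
      ∀ a, a • x ∈ wedgeB (MvPolynomial ι (PolyR n)) X ω p → a ∈ P :=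
    exists_isPrime_annihilator p x hxB
  have hL : ∀ θ, ∑ i, C (ω i θ) * X i ∈ P := fun θ => hPx _
    (smul_mem_wedgeB (MvPolynomial ι (PolyR n)) X ω
      (Module.Dual.eval (PolyR n) (DerA f) θ : Module.Dual (PolyR n) (OmegaOne f)) p x hx)
  obtain ⟨h₁, h₂⟩ := finrank_le_of_annihilator hp hc hf hω p hex hpd P h' hP hL
    (Localization (P.comap C).primeCompl)
  obtain h | h := h
  · exact h.not_ge h₁
  · refine hpr.not_gt (h₂ ?_)
    have := hPx _ h
    rw [map_prod, Ideal.IsPrime.prod_mem_iff] at this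
    obtain ⟨i, -, hi⟩ := this
    exact ⟨i, hi⟩

lemma mem_wedgeB_of_lt (hp : ∀ i, Prime (f i))
    (hc : Pairwise fun i j => IsRelPrime (f i) (f j))
    {φ : ι → Fin n → ℂ} (hf : ∀ i, f i = linForm (φ i)) {ω : ι → OmegaOne f}
    (hω : ∀ i, f i • ω i = evalDer f (f i))
    (hpd : ∀ q ≤ Module.finrank ℂ (Submodule.span ℂ (Set.range φ)),
      ProjDimLE (PolyR n) q (ModuleCat.of (PolyR n) (OmegaP f q))) (p : ℕ)
    (hpr : p < Module.finrank ℂ (Submodule.span ℂ (Set.range φ)))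
    (x : MvPolynomial ι (PolyR n) ⊗[PolyR n] OmegaP f p)
    (hx : wedgeD (MvPolynomial ι (PolyR n)) X ω p x = 0) :
    x ∈ wedgeB (MvPolynomial ι (PolyR n)) X ω p := by
  induction p using Nat.strong_induction_on with
  | _ p ih =>
    exact mem_wedgeB_of_lt_or_smul_mem hp hc hf hω p hpr.le
      (fun q hq y hy => ih q hq (hq.trans hpr) y hy) (fun q hq => hpd q (hq.trans hpr.le)) x hx
      (Or.inl hpr)

/-- In top degree, closed forms are coboundaries as soon as a multiple by the defining polynomial
is a coboundary. -/
lemma mem_wedgeB_of_smul_mem (hp : ∀ i, Prime (f i))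
    (hc : Pairwise fun i j => IsRelPrime (f i) (f j))
    {φ : ι → Fin n → ℂ} (hf : ∀ i, f i = linForm (φ i)) {ω : ι → OmegaOne f}
    (hω : ∀ i, f i • ω i = evalDer f (f i)) {r : ℕ}
    (hr : r = Module.finrank ℂ (Submodule.span ℂ (Set.range φ)))
    (hpd : ∀ q ≤ r, ProjDimLE (PolyR n) q (ModuleCat.of (PolyR n) (OmegaP f q)))
    (x : MvPolynomial ι (PolyR n) ⊗[PolyR n] OmegaP f r)
    (hx : wedgeD (MvPolynomial ι (PolyR n)) X ω r x = 0)
    (h : (C (∏ i, f i) : MvPolynomial ι (PolyR n)) • x ∈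
        wedgeB (MvPolynomial ι (PolyR n)) X ω r) :
    x ∈ wedgeB (MvPolynomial ι (PolyR n)) X ω r := by
  subst hr
  exact mem_wedgeB_of_lt_or_smul_mem hp hc hf hω _ le_rfl (fun q hq y hy =>
    mem_wedgeB_of_lt hp hc hf hω hpd q hq y hy) hpd x hx (Or.inr h)

end Exactness

section ExteriorPower

variable {R N : Type} [CommRing R] [IsDomain R] [AddCommGroup N] [Module R N]

/-- An alternating map all of whose values are divisible by `c ≠ 0` is a multiple of `c`. -/
lemma AlternatingMap.exists_mul_eq_of_dvd {r : ℕ} {c : R} (hc : c ≠ 0) (Δ : N [⋀^Fin r]→ₗ[R] R)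
    (h : ∀ m, c ∣ Δ m) :
    ∃ ψ : Module.Dual R (⋀[R]^r N), ∀ m, c * ψ (exteriorPower.ιMulti R r m) = Δ m := by
  obtain ⟨ψ, hψ⟩ := LinearMap.exists_smul_eq_of_dvd hc
    (exteriorPower.alternatingMapLinearEquiv Δ) (by
      intro x
      have hx : x ∈ Submodule.span R (Set.range (exteriorPower.ιMulti R r (M := N))) := by
        rw [exteriorPower.ιMulti_span]
        trivial
      induction hx using Submodule.span_induction with
      | mem x hx =>
        obtain ⟨m, rfl⟩ := hx
        rw [exteriorPower.alternatingMapLinearEquiv_apply_ιMulti]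
        exact h m
      | zero => simp
      | add x y _ _ hx hy => rw [map_add]; exact dvd_add hx hy
      | smul c x _ hx => rw [map_smul]; exact hx.mul_left c)
  refine ⟨ψ, fun m => ?_⟩
  rw [← exteriorPower.alternatingMapLinearEquiv_apply_ιMulti Δ m, ← hψ]
  rfl

lemma Matrix.pow_dvd_det {r : ℕ} (A : Matrix (Fin r) (Fin r) R) (g : R) (k : Fin r)
    (q : Fin r → R) (h : ∀ b, b ≠ k → ∃ w : Fin r → R, ∀ a, A b a = g * w a + q b * A k a) :
    g ^ (r - 1) ∣ A.det := by
  classical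
  choose! w hw using h
  let B : Matrix (Fin r) (Fin r) R := Matrix.of (Function.update w k (A k))
  let d : Fin r → R := Function.update (fun _ => g) k 1
  have h1 : A.det = (Matrix.of fun b a => d b * B b a).det := by
    refine Matrix.det_eq_of_forall_row_eq_smul_add_const (Function.update q k 0) k (by simp) ?_
    intro b a
    by_cases hb : b = k
    · subst hb
      simp [d, B]
    · simp [d, B, Function.update_of_ne hb, hw b hb a]
  rw [h1, Matrix.det_mul_column]
  refine Dvd.dvd.mul_right ?_ _
  rw [Finset.prod_update_of_mem (Finset.mem_univ k), one_mul, Finset.prod_const,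
    Finset.card_sdiff_of_subset (Finset.subset_univ _)]
  simp

/-- If a combination of the `y_a` with one invertible coefficient is divisible by `g`, then so are
the values of alternating forms at `y`. -/
lemma dvd_apply_ιMulti {R N : Type} [CommRing R] [AddCommGroup N] [Module R N] {r : ℕ}
    (y : Fin r → N) {g : R} {w : N} {c : Fin r → R} {k : Fin r}
    (hk : IsUnit (c k)) (hw : g • w = ∑ a, c a • y a) (χ : Module.Dual R (⋀[R]^r N)) :
    g ∣ χ (exteriorPower.ιMulti R r y) := by
  classical
  have h1 : χ (exteriorPower.ιMulti R r (Function.update y k (g • w))) =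
      c k * χ (exteriorPower.ιMulti R r y) := by
    rw [hw, AlternatingMap.map_update_sum, map_sum, Finset.sum_eq_single k]
    · rw [AlternatingMap.map_update_smul, Function.update_eq_self, map_smul, smul_eq_mul]
    · intro a _ hak
      rw [AlternatingMap.map_update_smul, AlternatingMap.map_update_self _ _ hak.symm,
        smul_zero, map_zero]
    · exact fun h => absurd (Finset.mem_univ k) h
  rw [AlternatingMap.map_update_smul, map_smul, smul_eq_mul] at h1
  exact hk.dvd_mul_left.1 ⟨_, h1.symm⟩

lemma apply_wedgeLeft_ιMulti {r : ℕ} (y : Fin r → N) {g : R} (hg : g ≠ 0) {w : N} {c : Fin r → R}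
    (hw : g • w = ∑ a, c a • y a) (χ : Module.Dual R (⋀[R]^(r + 1) N)) :
    χ (wedgeLeft w r (exteriorPower.ιMulti R r y)) = 0 := by
  have h2 : g • wedgeLeft w r (exteriorPower.ιMulti R r y) = 0 := by
    refine Subtype.ext ?_
    rw [Submodule.coe_smul, wedgeLeft_coe, ← smul_mul_assoc, ← map_smul, hw, map_sum,
      Finset.sum_mul]
    refine Finset.sum_eq_zero fun a _ => ?_
    have h3 := ExteriorAlgebra.ιMulti_succ_apply (R := R) (Fin.cons (y a) y : Fin (r + 1) → N)
    rw [AlternatingMap.map_eq_zero_of_eq _ (Fin.cons (y a) y : Fin (r + 1) → N) (i := 0)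
      (j := a.succ) (by simp) (Fin.succ_ne_zero a).symm] at h3
    have h4 : Matrix.vecTail (Fin.cons (y a) y : Fin (r + 1) → N) = y := by
      ext1 b
      simp [Matrix.vecTail]
    rw [h4, Fin.cons_zero] at h3
    rw [map_smul, smul_mul_assoc, exteriorPower.ιMulti_apply_coe, ← h3, smul_zero]
  refine (mul_eq_zero.1 ?_).resolve_left hg
  rw [← smul_eq_mul, ← map_smul, h2, map_zero]

/-- If each `c_i ω_i` is a combination of the `y_a` with some invertible coefficient, then
`y_1 ∧ ⋯ ∧ y_r` is divisible by `∏ c_i` in the double dual, and the quotient is annihilated by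
all the `ω_i`. -/
lemma exists_prod_mul_eq_ιMulti [DecompositionMonoid R] {c : ι → R} (hc0 : ∀ i, c i ≠ 0)
    (hc : Pairwise fun i j => IsRelPrime (c i) (c j)) {ω : ι → N} {r : ℕ} (y : Fin r → N)
    (q : ι → Fin r → R) (hy : ∀ i, c i • ω i = ∑ a, q i a • y a)
    (hq : ∀ i, ∃ k, IsUnit (q i k)) :
    ∃ η : DD R N r, (∀ χ, (∏ i, c i) * η χ = χ (exteriorPower.ιMulti R r y)) ∧
      ∀ i, ddWedge (ω i) r η = 0 := by
  have hF0 : ∏ i, c i ≠ 0 := Finset.prod_ne_zero_iff.2 fun i _ => hc0 i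
  obtain ⟨η, hη⟩ := LinearMap.exists_smul_eq_of_dvd hF0 (Module.Dual.eval R
    (⋀[R]^r N) (exteriorPower.ιMulti R r y)) fun χ => Fintype.prod_dvd_of_isRelPrime hc fun i => by
        obtain ⟨k, hk⟩ := hq i
        exact dvd_apply_ιMulti y hk (hy i) χ
  have hη' : ∀ χ, (∏ i, c i) * η χ = χ (exteriorPower.ιMulti R r y) :=
    fun χ => LinearMap.congr_fun hη χ
  refine ⟨η, hη', fun i => LinearMap.ext fun χ => ?_⟩
  rw [ddWedge_apply, LinearMap.zero_apply]
  refine (mul_eq_zero.1 ?_).resolve_left hF0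
  rw [hη']
  exact apply_wedgeLeft_ιMulti y (hc0 i) (hy i) χ

end ExteriorPower

section TopForm

variable {f : ι → PolyR n}

/-- The derivation `g ∂_w`. -/
def dirDer (g : PolyR n) (w : Fin n → ℂ) : Derivation ℂ (PolyR n) (PolyR n) :=
  mkDerivation ℂ fun j => g * C (w j)

lemma dirDer_linForm (g : PolyR n) (w u : Fin n → ℂ) :
    dirDer g w (linForm u) = g * C (u ⬝ᵥ w) := by
  rw [dirDer, mkDerivation_linForm, dotProduct, map_sum, Finset.mul_sum]
  exact Finset.sum_congr rfl fun j _ => by rw [map_mul, mul_left_comm]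

/-- Reindexed dual bases of the span of the linear forms. -/
lemma exists_dual_basis (φ : ι → Fin n → ℂ) {r : ℕ}
    (hr : r = Module.finrank ℂ (Submodule.span ℂ (Set.range φ))) :
    ∃ (τ : Fin r → ι) (v : Fin r → Fin n → ℂ), (∀ a, φ (τ a) ⬝ᵥ v a = 1) ∧
      (∀ a b, a ≠ b → φ (τ b) ⬝ᵥ v a = 0) ∧ ∀ j, φ j = ∑ a, (φ j ⬝ᵥ v a) • φ (τ a) := by
  obtain ⟨I₁, I₂, v, -, -, -, hcard, hv1, hv0, -, -, hv⟩ := exists_adapted_basis φ ∅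
  let e : Fin r ≃ I₂ := (I₂.equivFinOfCardEq (hcard.trans hr.symm)).symm
  refine ⟨fun a => e a, fun a => v (e a), fun a => hv1 _ (e a).2,
    fun a b hab => hv0 _ (e a).2 _ (e b).2 fun h => hab (e.injective (Subtype.ext h)), fun j => ?_⟩
  rw [e.sum_comp fun i => (φ j ⬝ᵥ v i) • φ i, Finset.sum_coe_sort I₂ fun i => (φ j ⬝ᵥ v i) • φ i]
  exact hv j

lemma dirDer_mem_DerA (hp : ∀ i, Prime (f i)) (hc : Pairwise fun i j => IsRelPrime (f i) (f j))
    {φ : ι → Fin n → ℂ} (hf : ∀ i, f i = linForm (φ i)) {g : PolyR n} {w : Fin n → ℂ}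
    (h : ∀ i, f i ∣ g ∨ φ i ⬝ᵥ w = 0) : dirDer g w ∈ DerA f := by
  refine (mem_DerA_iff hp hc).2 fun i => ?_
  rw [hf i, dirDer_linForm, ← hf i]
  obtain h | h := h i
  · exact h.mul_right _
  · rw [h, map_zero, mul_zero]
    exact dvd_zero _

lemma dvd_det_apply_dirDer (hp : ∀ i, Prime (f i))
    (hc : Pairwise fun i j => IsRelPrime (f i) (f j))
    {φ : ι → Fin n → ℂ} (hf : ∀ i, f i = linForm (φ i)) {r : ℕ} {v : Fin r → Fin n → ℂ}
    (hv : ∀ i, ∃ a, φ i ⬝ᵥ v a ≠ 0) (δ : Fin r → DerA f)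
    (hδ : ∀ a, (δ a : Derivation ℂ (PolyR n) (PolyR n)) = dirDer (∏ i, f i) (v a))
    (m : Fin r → OmegaOne f) :
    (∏ i, f i) ^ (r - 1) ∣ (Matrix.of fun b a => m a (δ b)).det := by
  classical
  rw [← Finset.prod_pow]
  refine Fintype.prod_dvd_of_isRelPrime (fun i j hij => (hc hij).pow) fun i => ?_
  obtain ⟨k, hk⟩ := hv i
  refine Matrix.pow_dvd_det _ _ k (fun b => C ((φ i ⬝ᵥ v b) / (φ i ⬝ᵥ v k))) fun b _ => ?_
  set q : ℂ := (φ i ⬝ᵥ v b) / (φ i ⬝ᵥ v k) with hq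
  have hε : dirDer (∏ j ∈ Finset.univ.erase i, f j) (v b - q • v k) ∈ DerA f := by
    refine dirDer_mem_DerA hp hc hf fun j => ?_
    by_cases hij : j = i
    · subst hij
      right
      rw [dotProduct_sub, dotProduct_smul, smul_eq_mul, hq, div_mul_cancel₀ _ hk, sub_self]
    · exact Or.inl (Finset.dvd_prod_of_mem f (Finset.mem_erase.2 ⟨hij, Finset.mem_univ j⟩))
  have h2 : δ b = f i • (⟨_, hε⟩ : DerA f) + (C q : PolyR n) • δ k := by
    refine Subtype.ext (MvPolynomial.derivation_ext fun j => ?_)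
    rw [Submodule.coe_add, Submodule.coe_smul, Submodule.coe_smul, hδ, hδ]
    simp only [dirDer, Derivation.add_apply, Derivation.smul_apply, mkDerivation_X, smul_eq_mul,
      Pi.sub_apply, Pi.smul_apply, map_sub, map_mul]
    rw [← Finset.mul_prod_erase _ _ (Finset.mem_univ i)]
    ring
  refine ⟨fun a => m a ⟨_, hε⟩, fun a => ?_⟩
  rw [Matrix.of_apply, Matrix.of_apply, h2, map_add, map_smul, map_smul, smul_eq_mul, smul_eq_mul]

/-- A functional on `Λ^r Ω¹(A)` taking the value `f` at `dy_1 ∧ ⋯ ∧ dy_r`. -/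
lemma exists_top_functional (hp : ∀ i, Prime (f i))
    (hc : Pairwise fun i j => IsRelPrime (f i) (f j))
    {φ : ι → Fin n → ℂ} (hf : ∀ i, f i = linForm (φ i)) {r : ℕ} (hr0 : r ≠ 0)
    {τ : Fin r → ι} {v : Fin r → Fin n → ℂ} (hv1 : ∀ a, φ (τ a) ⬝ᵥ v a = 1)
    (hv0 : ∀ a b, a ≠ b → φ (τ b) ⬝ᵥ v a = 0) (hv : ∀ i, ∃ a, φ i ⬝ᵥ v a ≠ 0) :
    ∃ ψ : Module.Dual (PolyR n) (⋀[PolyR n]^r (OmegaOne f)),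
      ψ (exteriorPower.ιMulti (PolyR n) r fun a => evalDer f (f (τ a))) = ∏ i, f i := by
  classical
  have hF0 : ∏ i, f i ≠ 0 := Finset.prod_ne_zero_iff.2 fun i _ => (hp i).ne_zero
  have hδ : ∀ w, dirDer (∏ i, f i) w ∈ DerA f := fun w => dirDer_mem_DerA hp hc hf
    fun i => Or.inl (Finset.dvd_prod_of_mem f (Finset.mem_univ i))
  obtain ⟨δ, hδv⟩ : ∃ δ : Fin r → DerA f, ∀ a,
      (δ a : Derivation ℂ (PolyR n) (PolyR n)) = dirDer (∏ i, f i) (v a) :=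
    ⟨fun b => ⟨dirDer _ (v b), hδ _⟩, fun _ => rfl⟩
  let Δ : OmegaOne f [⋀^Fin r]→ₗ[PolyR n] PolyR n := Matrix.detRowAlternating.compLinearMap
    (LinearMap.pi fun b => Module.Dual.eval (PolyR n) (DerA f) (δ b))
  have hΔ : ∀ m, Δ m = (Matrix.of fun b a => m a (δ b)).det := fun m => by
    rw [← Matrix.det_transpose]
    rfl
  obtain ⟨ψ, hψ⟩ := AlternatingMap.exists_mul_eq_of_dvd (pow_ne_zero (r - 1) hF0) Δ fun m => by
    rw [hΔ]
    exact dvd_det_apply_dirDer hp hc hf hv δ hδv m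
  refine ⟨ψ, mul_left_cancel₀ (pow_ne_zero (r - 1) hF0) ?_⟩
  have h2 : (Matrix.of fun b a => evalDer f (f (τ a)) (δ b)) =
      Matrix.diagonal fun _ => ∏ i, f i := by
    ext1 b a
    rw [Matrix.of_apply, evalDer_apply, hδv, hf (τ a), dirDer_linForm]
    by_cases hab : b = a
    · subst hab
      rw [hv1, Matrix.diagonal_apply_eq, map_one, mul_one]
    · rw [hv0 _ _ hab, Matrix.diagonal_apply_ne _ hab, map_zero, mul_zero]
  rw [hψ, hΔ, h2, Matrix.det_diagonal, Finset.prod_const, Finset.card_univ, Fintype.card_fin,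
    ← pow_succ, Nat.sub_one_add_one hr0]

/-- The module `Ω^r(A)`, where `r` is the rank of the arrangement, contains a form annihilated by
all the `df_i / f_i` and on which a functional takes the value `1`. -/
lemma exists_top_form (hp : ∀ i, Prime (f i))
    (hc : Pairwise fun i j => IsRelPrime (f i) (f j))
    {φ : ι → Fin n → ℂ} (hf : ∀ i, f i = linForm (φ i)) {ω : ι → OmegaOne f}
    (hω : ∀ i, f i • ω i = evalDer f (f i)) {r : ℕ}
    (hr : r = Module.finrank ℂ (Submodule.span ℂ (Set.range φ))) (hr0 : r ≠ 0) :
    ∃ (η : OmegaP f r) (ψ : Module.Dual (PolyR n) (⋀[PolyR n]^r (OmegaOne f))),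
      η ψ = 1 ∧ ∀ i, ddWedge (ω i) r η = 0 := by
  obtain ⟨τ, v, hv1, hv0, hv⟩ := exists_dual_basis φ hr
  have hF0 : ∏ i, f i ≠ 0 := Finset.prod_ne_zero_iff.2 fun i _ => (hp i).ne_zero
  have hy : ∀ i, f i • ω i = ∑ a, (C (φ i ⬝ᵥ v a) : PolyR n) • evalDer f (f (τ a)) := by
    intro i
    rw [hω]
    ext1 θ
    rw [LinearMap.sum_apply, evalDer_apply]
    conv_lhs => rw [hf, hv i, map_sum, map_sum]
    refine Finset.sum_congr rfl fun a _ => ?_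
    rw [map_smul, Derivation.map_smul, ← hf, smul_eq_C_mul]
    rfl
  have hne : ∀ i, ∃ a, φ i ⬝ᵥ v a ≠ 0 := by
    intro i
    by_contra! h
    have h0 : φ i = 0 := by
      rw [hv i]
      exact Finset.sum_eq_zero fun a _ => by rw [h, zero_smul]
    exact (hp i).ne_zero (by rw [hf, h0, map_zero])
  obtain ⟨ψ, hψ⟩ := exists_top_functional hp hc hf hr0 hv1 hv0 hne
  have hu : ∀ i, ∃ k, IsUnit (C (φ i ⬝ᵥ v k) : PolyR n) := fun i =>
    (hne i).imp fun k hk => (Ne.isUnit hk).map C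
  have key := exists_prod_mul_eq_ιMulti (R := PolyR n) (N := OmegaOne f)
    (fun i => (hp i).ne_zero) hc (fun a => evalDer f (f (τ a)))
    (fun i a => (C (φ i ⬝ᵥ v a) : PolyR n)) hy hu
  exact key.imp fun η hη => ⟨ψ, mul_left_cancel₀ hF0
    (((hη.1 ψ).trans hψ).trans (mul_one _).symm), hη.2⟩

lemma subsingleton_OmegaP_of_lt (hp : ∀ i, Prime (f i))
    (hc : Pairwise fun i j => IsRelPrime (f i) (f j)) {φ : ι → Fin n → ℂ}
    (hf : ∀ i, f i = linForm (φ i)) {p : ℕ} (hnp : n < p) : Subsingleton (OmegaP f p) := by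
  classical
  set F := ∏ i, f i with hF
  have hF0 : F ≠ 0 := Finset.prod_ne_zero_iff.2 fun i _ => (hp i).ne_zero
  have hδ : ∀ w, dirDer F w ∈ DerA f := fun w => dirDer_mem_DerA hp hc hf
    fun i => Or.inl (Finset.dvd_prod_of_mem f (Finset.mem_univ i))
  let δ : Fin n → DerA f := fun j => ⟨dirDer F (Pi.single j 1), hδ _⟩
  let E : OmegaOne f →ₗ[PolyR n] Fin n → PolyR n :=
    LinearMap.pi fun j => Module.Dual.eval (PolyR n) (DerA f) (δ j)
  have hE : LinearMap.ker E = ⊥ := by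
    rw [LinearMap.ker_eq_bot']
    intro m hm
    ext1 θ
    have h1 : F • θ = ∑ j, (θ : Derivation ℂ (PolyR n) (PolyR n)) (X j) • δ j := by
      refine Subtype.ext (MvPolynomial.derivation_ext fun i => ?_)
      rw [AddSubmonoidClass.coe_finsetSum, ← Derivation.coeFnAddMonoidHom_apply,
        ← Derivation.coeFnAddMonoidHom_apply, map_sum, Finset.sum_apply]
      simp only [Derivation.coeFnAddMonoidHom_apply, Submodule.coe_smul, Derivation.smul_apply,
        δ, dirDer, mkDerivation_X, smul_eq_mul]
      rw [Finset.sum_eq_single i]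
      · rw [Pi.single_eq_same, map_one, mul_one, mul_comm]
      · intro j _ hj
        rw [Pi.single_eq_of_ne hj.symm, map_zero, mul_zero, mul_zero]
      · exact fun h => absurd (Finset.mem_univ i) h
    refine (mul_eq_zero.1 ?_).resolve_left hF0
    rw [← smul_eq_mul, ← map_smul, h1, map_sum]
    refine Finset.sum_eq_zero fun j _ => ?_
    rw [map_smul, show m (δ j) = 0 from congrFun hm j, smul_zero]
  have : Subsingleton (Module.Dual (PolyR n) (⋀[PolyR n]^p (OmegaOne f))) := by
    refine subsingleton_of_forall_eq 0 fun χ => exteriorPower.linearMap_ext ?_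
    ext1 m
    rw [LinearMap.zero_compAlternatingMap, AlternatingMap.zero_apply]
    refine AlternatingMap.map_linearDependent _ m fun hm => ?_
    have h1 := (hm.map' E hE).fintype_card_le_finrank
    rw [Fintype.card_fin, Module.finrank_fin_fun] at h1
    omega
  exact subsingleton_of_forall_eq 0 fun η => LinearMap.ext fun χ => by
    rw [Subsingleton.elim χ 0, map_zero, map_zero]

lemma finrank_le_arrRank (hp : ∀ i, Prime (f i))
    (hc : Pairwise fun i j => IsRelPrime (f i) (f j))
    {φ : ι → Fin n → ℂ} (hf : ∀ i, f i = linForm (φ i))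
    (hr0 : Module.finrank ℂ (Submodule.span ℂ (Set.range φ)) ≠ 0) :
    Module.finrank ℂ (Submodule.span ℂ (Set.range φ)) ≤ arrRank f := by
  refine le_csInf ⟨n, fun p hnp => subsingleton_OmegaP_of_lt hp hc hf hnp⟩ fun k hk => ?_
  by_contra! h
  have := hk _ h
  obtain ⟨ω, hω⟩ := exists_dlog hp hc
  obtain ⟨η, ψ, h1, -⟩ := exists_top_form hp hc hf hω rfl hr0
  rw [Subsingleton.elim η 0, LinearMap.zero_apply] at h1
  exact zero_ne_one h1

end TopForm

section DlogIdeal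

open scoped TensorProduct

variable {R M : Type} [CommRing R] [AddCommGroup M] [Module R M]
variable (A : Type) [CommRing A] [Algebra R A] (s : ι → A) (ω : ι → M)

variable (R) in
/-- The ideal generated by the combinations `Σ_i ξ(ω_i) s_i` for `ξ` in the dual of `M`. -/
def dlogIdeal : Ideal A :=
  Ideal.span (Set.range fun ξ : Module.Dual R M => ∑ i, algebraMap R A (ξ (ω i)) * s i)

lemma smul_mem_wedgeB_of_mem_dlogIdeal {h : A} (hh : h ∈ dlogIdeal R A s ω) (p : ℕ)
    (x : A ⊗[R] DD R M p) (hx : wedgeD A s ω p x = 0) : h • x ∈ wedgeB A s ω p := by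
  induction hh using Submodule.span_induction with
  | mem h hh =>
    obtain ⟨ξ, rfl⟩ := hh
    exact smul_mem_wedgeB A s ω ξ p x hx
  | zero => simp
  | add a b _ _ ha hb => rw [add_smul]; exact Submodule.add_mem _ ha hb
  | smul c a _ ha => rw [smul_assoc]; exact Submodule.smul_mem _ c ha

/-- The functional `m ↦ η (ψ ∘ (m ∧ ·))`. -/
def wedgeDual (p : ℕ) (η : DD R M p) (ψ : Module.Dual R (⋀[R]^(p + 1) M)) : Module.Dual R M where
  toFun m := ddWedge m p η ψ
  map_add' a b := by
    have h : wedgeLeft (a + b) p = wedgeLeft (R := R) a p + wedgeLeft b p := by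
      ext1
      ext
      simp [add_mul]
    rw [ddWedge_apply, ddWedge_apply, ddWedge_apply, h, LinearMap.comp_add, map_add]
  map_smul' c a := by
    have h : wedgeLeft (c • a) p = c • wedgeLeft (R := R) a p := by
      ext1
      ext
      simp
    rw [ddWedge_apply, ddWedge_apply, h, LinearMap.comp_smul, map_smul]
    rfl

lemma liftBaseChange_wedgeD_mem_dlogIdeal (p : ℕ) (ψ : Module.Dual R (⋀[R]^(p + 1) M))
    (x : A ⊗[R] DD R M p) :
    LinearMap.liftBaseChange A (Algebra.linearMap R A ∘ₗ Module.Dual.eval R _ ψ)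
      (wedgeD A s ω p x) ∈ dlogIdeal R A s ω := by
  induction x using TensorProduct.induction_on with
  | zero => rw [map_zero, map_zero]; exact Submodule.zero_mem _
  | add x y hx hy => rw [map_add, map_add]; exact Submodule.add_mem _ hx hy
  | tmul a η =>
    have h : LinearMap.liftBaseChange A (Algebra.linearMap R A ∘ₗ Module.Dual.eval R _ ψ)
        (wedgeD A s ω p (a ⊗ₜ η)) =
        a • ∑ i, algebraMap R A (wedgeDual p η ψ (ω i)) * s i := by
      rw [wedgeD_apply, map_sum, Finset.smul_sum]
      refine Finset.sum_congr rfl fun i _ => ?_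
      rw [map_smul, LinearMap.baseChange_tmul, LinearMap.liftBaseChange_tmul, smul_eq_mul,
        smul_eq_mul, smul_eq_mul]
      change s i * (a * algebraMap R A (wedgeDual p η ψ (ω i))) = _
      ring
    rw [h]
    exact Submodule.smul_mem _ _ (Ideal.subset_span ⟨_, rfl⟩)

/-- If `h ⊗ η` is a boundary and some functional takes the value `1` at `η`, then `h` lies in
the ideal generated by the `Σ_i ξ(ω_i) s_i`. -/
lemma mem_dlogIdeal_of_tmul_mem_wedgeB {p : ℕ} (hp : p ≠ 0) {η : DD R M p}
    {ψ : Module.Dual R (⋀[R]^p M)} (hη : η ψ = 1) {h : A} (hh : h ⊗ₜ η ∈ wedgeB A s ω p) :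
    h ∈ dlogIdeal R A s ω := by
  obtain _ | p := p
  · exact absurd rfl hp
  · obtain ⟨ζ, hζ⟩ := hh
    have h1 := liftBaseChange_wedgeD_mem_dlogIdeal A s ω p ψ ζ
    rw [hζ, LinearMap.liftBaseChange_tmul] at h1
    have h2 : (Algebra.linearMap R A ∘ₗ Module.Dual.eval R _ ψ) η = 1 := by
      change algebraMap R A (η ψ) = 1
      rw [hη, map_one]
    rwa [h2, smul_eq_mul, mul_one] at h1

lemma mem_dlogIdeal_of_mul_mem {p : ℕ} (hp : p ≠ 0) {c : A}
    (hc : ∀ x : A ⊗[R] DD R M p, wedgeD A s ω p x = 0 → c • x ∈ wedgeB A s ω p → x ∈ wedgeB A s ω p)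
    {η : DD R M p} (hη : ∀ i, ddWedge (ω i) p η = 0) {ψ : Module.Dual R (⋀[R]^p M)}
    (hψ : η ψ = 1) {h : A} (hh : c * h ∈ dlogIdeal R A s ω) : h ∈ dlogIdeal R A s ω := by
  have hD : ∀ a : A, wedgeD A s ω p (a ⊗ₜ η) = 0 := by
    intro a
    rw [wedgeD_apply]
    refine Finset.sum_eq_zero fun i _ => ?_
    rw [LinearMap.baseChange_tmul, hη, TensorProduct.tmul_zero, smul_zero]
  refine mem_dlogIdeal_of_tmul_mem_wedgeB A s ω hp hψ (hc _ (hD _) ?_)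
  have h2 := smul_mem_wedgeB_of_mem_dlogIdeal A s ω hh p (1 ⊗ₜ η) (hD 1)
  rwa [mul_smul, TensorProduct.smul_tmul', smul_eq_mul, mul_one] at h2

end DlogIdeal

section Saturation

open scoped TensorProduct

variable {f : ι → PolyR n}

/-- Polynomials in `x` and `s` as polynomials in `s` with coefficients in `R`. -/
def polyRSEquiv (n : ℕ) (ι : Type) : PolyRS n ι ≃ₐ[ℂ] MvPolynomial ι (PolyR n) :=
  (renameEquiv ℂ (Equiv.sumComm (Fin n) ι)).trans (sumAlgEquiv ℂ ι (Fin n))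

lemma polyRSEquiv_X_inr {κ : Type} (i : κ) : polyRSEquiv n κ (X (Sum.inr i)) = X i := by
  simp [polyRSEquiv]

lemma polyRSEquiv_rename_inl {κ : Type} (a : PolyR n) :
    polyRSEquiv n κ (rename Sum.inl a) = C a := by
  have h := DFunLike.congr_fun (sumAlgEquiv_comp_rename_inr (R := ℂ) (S₁ := κ) (S₂ := Fin n)) a
  simpa [polyRSEquiv, rename_rename, Function.comp_def] using h

lemma mem_preLikelihoodIdeal_iff (hp : ∀ i, Prime (f i))
    (hc : Pairwise fun i j => IsRelPrime (f i) (f j))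
    {φ : ι → Fin n → ℂ} (hf : ∀ i, f i = linForm (φ i)) {ω : ι → OmegaOne f}
    (hω : ∀ i, f i • ω i = evalDer f (f i)) {g : PolyRS n ι} :
    g ∈ preLikelihoodIdeal f ↔
      polyRSEquiv n ι g ∈ dlogIdeal (PolyR n) (MvPolynomial ι (PolyR n)) X ω := by
  have h1 : Ideal.map (polyRSEquiv n ι : PolyRS n ι →+* MvPolynomial ι (PolyR n))
      (preLikelihoodIdeal f) = dlogIdeal (PolyR n) (MvPolynomial ι (PolyR n)) X ω := by
    rw [preLikelihoodIdeal, Ideal.map_span]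
    have key : ∀ a : ι → PolyR n, (polyRSEquiv n ι : PolyRS n ι →+* MvPolynomial ι (PolyR n))
        (∑ i, rename Sum.inl (a i) * X (Sum.inr i)) = ∑ i, C (a i) * X i := by
      intro a
      rw [map_sum]
      refine Finset.sum_congr rfl fun i _ => ?_
      rw [map_mul]
      exact congrArg₂ _ (polyRSEquiv_rename_inl _) (polyRSEquiv_X_inr _)
    refine le_antisymm (Ideal.span_le.2 ?_) (Ideal.span_le.2 ?_)
    · rintro _ ⟨_, ⟨a, ha, rfl⟩, rfl⟩
      obtain ⟨θ, hθ⟩ := (mem_logDer_iff hp hc hf hω).1 ha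
      rw [key]
      refine Ideal.subset_span ⟨-(Module.Dual.eval (PolyR n) (DerA f) θ :
        Module.Dual (PolyR n) (OmegaOne f)), Finset.sum_congr rfl fun i _ => ?_⟩
      rw [hθ]
      rfl
    · rintro _ ⟨ξ, rfl⟩
      refine Ideal.subset_span ⟨_, ⟨_, neg_apply_mem_logDer hf hω (-ξ), rfl⟩, ?_⟩
      rw [key]
      exact Finset.sum_congr rfl fun i _ => by rw [LinearMap.neg_apply, neg_neg]; rfl
  rw [← h1]
  refine ⟨fun hg => Ideal.mem_map_of_mem _ hg, fun hg => ?_⟩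
  obtain ⟨g', hg', h2⟩ := (Ideal.mem_map_iff_of_surjective _
    (polyRSEquiv n ι).surjective).1 hg
  rwa [← (polyRSEquiv n ι).injective h2]

/-- The pre-likelihood ideal of a tame arrangement is saturated with respect to `f`. -/
lemma mem_preLikelihoodIdeal_of_mul_mem (hp : ∀ i, Prime (f i))
    (hc : Pairwise fun i j => IsRelPrime (f i) (f j))
    {φ : ι → Fin n → ℂ} (hf : ∀ i, f i = linForm (φ i)) [Nonempty ι] (htame : IsTame f)
    {g : PolyRS n ι} (h : rename Sum.inl (∏ i, f i) * g ∈ preLikelihoodIdeal f) :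
    g ∈ preLikelihoodIdeal f := by
  obtain ⟨r, hr⟩ : ∃ r, r = Module.finrank ℂ (Submodule.span ℂ (Set.range φ)) := ⟨_, rfl⟩
  have hr0 : r ≠ 0 := by
    rw [hr, Ne, Submodule.finrank_eq_zero, Submodule.span_eq_bot]
    intro h0
    obtain ⟨i⟩ := ‹Nonempty ι›
    exact (hp i).ne_zero (by rw [hf, h0 _ ⟨i, rfl⟩, map_zero])
  have hpd : ∀ q ≤ r, ProjDimLE (PolyR n) q (ModuleCat.of (PolyR n) (OmegaP f q)) :=
    fun q hq => htame q (hq.trans (hr ▸ finrank_le_arrRank hp hc hf (hr ▸ hr0)))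
  obtain ⟨ω, hω⟩ := exists_dlog hp hc
  rw [mem_preLikelihoodIdeal_iff hp hc hf hω] at h ⊢
  rw [map_mul, polyRSEquiv_rename_inl] at h
  have key := exists_top_form hp hc hf hω hr hr0
  exact key.elim fun η hη => hη.elim fun ψ hψ => mem_dlogIdeal_of_mul_mem
    (MvPolynomial ι (PolyR n)) X ω hr0 (mem_wedgeB_of_smul_mem hp hc hf hω hr hpd) hψ.2 hψ.1 h

end Saturation

section Likelihood

variable {f : ι → PolyR n}

lemma preLikelihoodIdeal_le_likelihoodIdeal [DecidableEq ι] (f : ι → PolyR n) :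
    preLikelihoodIdeal f ≤ likelihoodIdeal f := by
  refine Ideal.span_le.2 ?_
  rintro _ ⟨a, ⟨b, hb⟩, rfl⟩ ⟨x, s⟩ ⟨hx, -, hs⟩
  simp only at hx hs ⊢
  have hP : ∏ k, eval x (f k) ≠ 0 := Finset.prod_ne_zero_iff.2 fun k _ => hx k
  have hb' : ∀ i, eval x (a i) * eval x (f i) =
      -∑ j, eval x (b j) * eval x (pderiv j (f i)) := fun i => by
    have h := congrArg (eval x) (hb i)
    simp only [map_add, map_mul, map_sum, map_zero] at h
    exact eq_neg_of_add_eq_zero_left h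
  refine (mul_eq_zero.1 ?_).resolve_left hP
  calc (∏ k, eval x (f k)) * eval (Sum.elim x s) (∑ i, rename Sum.inl (a i) * X (Sum.inr i))
      = ∑ i, (eval x (a i) * eval x (f i)) *
          (s i * ∏ k ∈ Finset.univ.erase i, eval x (f k)) := by
        rw [map_sum, Finset.mul_sum]
        refine Finset.sum_congr rfl fun i _ => ?_
        rw [map_mul, eval_rename, Sum.elim_comp_inl, eval_X, Sum.elim_inr,
          ← Finset.mul_prod_erase _ _ (Finset.mem_univ i)]
        ring
    _ = -∑ j, eval x (b j) * ∑ i, s i * eval x (pderiv j (f i)) *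
          ∏ k ∈ Finset.univ.erase i, eval x (f k) := by
        simp only [hb', Finset.mul_sum, neg_mul, Finset.sum_neg_distrib, Finset.sum_mul]
        rw [Finset.sum_comm]
        refine congrArg _ (Finset.sum_congr rfl fun j _ => Finset.sum_congr rfl fun i _ => ?_)
        ring
    _ = 0 := by simp [hs]

lemma mem_critLocus_iff [DecidableEq ι] {φ : ι → Fin n → ℂ} (hf : ∀ i, f i = linForm (φ i))
    {x : Fin n → ℂ} (hx : ∀ j, eval x (f j) ≠ 0) {s : ι → ℂ} :
    (x, s) ∈ critLocus f ↔ ∑ j, (s j / eval x (f j)) • φ j = 0 := by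
  have hJ : ∀ y, jacAt f y = Matrix.of φ := by
    intro y
    ext i j
    rw [jacAt, Matrix.of_apply, Matrix.of_apply, hf, pderiv_linForm, eval_C]
  have hP : ∏ k, eval x (f k) ≠ 0 := Finset.prod_ne_zero_iff.2 fun k _ => hx k
  have hr : (jacAt f x).rank = jacMaxRank f := by
    simp only [jacMaxRank, hJ, ciSup_const]
  have key : ∀ i : Fin n, ∑ j, s j * eval x (pderiv i (f j)) *
      ∏ k ∈ Finset.univ.erase j, eval x (f k) =
      (∏ k, eval x (f k)) * (∑ j, (s j / eval x (f j)) • φ j) i := by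
    intro i
    rw [Finset.sum_apply, Finset.mul_sum]
    refine Finset.sum_congr rfl fun j _ => ?_
    rw [hf j, pderiv_linForm, eval_C, ← hf j, Pi.smul_apply, smul_eq_mul,
      ← Finset.mul_prod_erase _ _ (Finset.mem_univ j)]
    field_simp [hx j]
  constructor
  · rintro ⟨-, -, h⟩
    ext1 i
    exact (mul_eq_zero.1 ((key i).symm.trans (h i))).resolve_left hP
  · intro h
    refine ⟨hx, hr, fun i => ?_⟩
    rw [key, h, Pi.zero_apply, mul_zero]

/-- The element of the pre-likelihood ideal given by the derivation `f ∂_w`. -/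
lemma dual_mem_preLikelihoodIdeal [DecidableEq ι] {φ : ι → Fin n → ℂ}
    (hf : ∀ i, f i = linForm (φ i)) (w : Fin n → ℂ) :
    ∑ j, rename Sum.inl (C (φ j ⬝ᵥ w) * ∏ k ∈ Finset.univ.erase j, f k) * X (Sum.inr j) ∈
      preLikelihoodIdeal f := by
  refine Ideal.subset_span ⟨_, ⟨fun j => -((∏ k, f k) * C (w j)), fun i => ?_⟩, rfl⟩
  have h : ∑ j, -((∏ k, f k) * C (w j)) * pderiv j (f i) = -((∏ k, f k) * C (φ i ⬝ᵥ w)) := by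
    rw [dotProduct, map_sum, Finset.mul_sum, ← Finset.sum_neg_distrib]
    refine Finset.sum_congr rfl fun j _ => ?_
    rw [hf i, pderiv_linForm, map_mul]
    ring
  rw [h, ← Finset.mul_prod_erase _ _ (Finset.mem_univ i)]
  ring

/-- Up to a power of `f`, the variables `s_i` with `i` in a basis can be eliminated modulo the
pre-likelihood ideal. -/
lemma exists_elimination {φ : ι → Fin n → ℂ} (hf : ∀ i, f i = linForm (φ i)) {I : Finset ι}
    {v : ι → Fin n → ℂ} (hv1 : ∀ i ∈ I, φ i ⬝ᵥ v i = 1)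
    (hv0 : ∀ i ∈ I, ∀ j ∈ I, i ≠ j → φ j ⬝ᵥ v i = 0) (g : PolyRS n ι) :
    ∃ (N : ℕ) (g' : PolyRS n ι),
      (∀ (x : Fin n → ℂ) (s s' : ι → ℂ), (∀ i, i ∉ I → s i = s' i) →
        eval (Sum.elim x s) g' = eval (Sum.elim x s') g') ∧
      rename Sum.inl (∏ i, f i) ^ N * g - g' ∈ preLikelihoodIdeal f := by
  classical
  set F : PolyRS n ι := rename Sum.inl (∏ i, f i) with hF
  have hFe : ∀ (x : Fin n → ℂ) (s s' : ι → ℂ), eval (Sum.elim x s) F = eval (Sum.elim x s') F := by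
    intro x s s'
    rw [hF, eval_rename, eval_rename, Sum.elim_comp_inl, Sum.elim_comp_inl]
  induction g using MvPolynomial.induction_on with
  | C a => exact ⟨0, C a, fun x s s' _ => by simp, by simp⟩
  | add p q hp hq =>
    obtain ⟨N, p', hp, hp'⟩ := hp
    obtain ⟨L, q', hq, hq'⟩ := hq
    refine ⟨N + L, F ^ L * p' + F ^ N * q', fun x s s' h => ?_, ?_⟩
    · simp only [map_add, map_mul, map_pow, hp x s s' h, hq x s s' h, hFe x s s']
    · have := Ideal.add_mem _ (Ideal.mul_mem_left _ (F ^ L) hp')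
        (Ideal.mul_mem_left _ (F ^ N) hq')
      convert this using 1
      ring
  | mul_X p i hp =>
    obtain ⟨N, p', hp, hp'⟩ := hp
    obtain ⟨K, c, hc, hc'⟩ : ∃ (K : ℕ) (c : PolyRS n ι),
        (∀ (x : Fin n → ℂ) (s s' : ι → ℂ), (∀ i, i ∉ I → s i = s' i) →
          eval (Sum.elim x s) c = eval (Sum.elim x s') c) ∧
        F ^ K * X i - c ∈ preLikelihoodIdeal f := by
      obtain j | i := i
      · exact ⟨0, X (Sum.inl j), fun x s s' _ => by simp, by simp⟩
      by_cases hi : i ∈ I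
      swap
      · exact ⟨0, X (Sum.inr i), fun x s s' h => by simp [h i hi], by simp⟩
      let c : PolyRS n ι := ∑ j ∈ Iᶜ, rename Sum.inl
        (C (φ j ⬝ᵥ v i) * ∏ k ∈ Finset.univ.erase j, f k) * X (Sum.inr j)
      refine ⟨1, -(rename Sum.inl (f i) * c), fun x s s' h => ?_, ?_⟩
      · simp only [c, map_neg, map_mul, map_sum, eval_rename, Sum.elim_comp_inl, eval_X,
          Sum.elim_inr]
        refine congrArg _ (congrArg _ (Finset.sum_congr rfl fun j hj => ?_))
        rw [h j (Finset.mem_compl.1 hj)]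
      · have h1 := Ideal.mul_mem_left _ (rename Sum.inl (f i))
          (dual_mem_preLikelihoodIdeal hf (v i))
        rw [← Finset.sum_add_sum_compl I, Finset.sum_eq_single_of_mem i hi fun j hj hji => by
          rw [hv0 i hi j hj hji.symm, map_zero, zero_mul, map_zero, zero_mul], hv1 i hi, map_one,
          one_mul, mul_add, ← mul_assoc, ← map_mul, Finset.mul_prod_erase _ _ (Finset.mem_univ i),
          ← hF] at h1
        rwa [pow_one, sub_neg_eq_add]
    refine ⟨N + K, p' * c, fun x s s' h => ?_, ?_⟩
    · rw [map_mul, map_mul, hp x s s' h, hc x s s' h]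
    · have := Ideal.add_mem _ (Ideal.mul_mem_left _ (F ^ K * X i) hp')
        (Ideal.mul_mem_left _ p' hc')
      convert this using 1
      ring

lemma exists_pow_mul_mem_preLikelihoodIdeal [DecidableEq ι] (hf0 : ∀ i, f i ≠ 0)
    {φ : ι → Fin n → ℂ} (hf : ∀ i, f i = linForm (φ i)) {g : PolyRS n ι}
    (hg : g ∈ likelihoodIdeal f) :
    ∃ N : ℕ, rename Sum.inl (∏ i, f i) ^ N * g ∈ preLikelihoodIdeal f := by
  obtain ⟨-, I, v, -, -, -, -, hv1, hv0, -, -, hv⟩ := exists_adapted_basis φ ∅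
  obtain ⟨N, g', hg', h⟩ := exists_elimination hf hv1 hv0 g
  refine ⟨N, ?_⟩
  have hI : g' ∈ likelihoodIdeal f := by
    rw [← sub_sub_self (rename Sum.inl (∏ i, f i) ^ N * g) g']
    exact Ideal.sub_mem _ (Ideal.mul_mem_left _ _ hg) (preLikelihoodIdeal_le_likelihoodIdeal f h)
  have h0 : rename Sum.inl (∏ i, f i) * g' = 0 := by
    refine MvPolynomial.funext fun y => ?_
    obtain ⟨x, t, rfl⟩ : ∃ x t, y = Sum.elim x t :=
      ⟨y ∘ Sum.inl, y ∘ Sum.inr, (Sum.elim_comp_inl_inr y).symm⟩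
    rw [map_mul, eval_rename, Sum.elim_comp_inl, map_zero, map_prod]
    by_cases hx : ∀ i, eval x (f i) ≠ 0
    swap
    · push Not at hx
      obtain ⟨i, hi⟩ := hx
      rw [Finset.prod_eq_zero (Finset.mem_univ i) hi, zero_mul]
    let s : ι → ℂ := fun i => if i ∈ I then
      -(eval x (f i) * ∑ j ∈ Iᶜ, t j / eval x (f j) * (φ j ⬝ᵥ v i)) else t i
    have hs : (x, s) ∈ critLocus f := by
      rw [mem_critLocus_iff hf hx]
      have h1 : ∀ i ∈ I, ∑ j, s j / eval x (f j) * (φ j ⬝ᵥ v i) = 0 := by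
        intro i hi
        rw [← Finset.sum_add_sum_compl I, Finset.sum_eq_single_of_mem i hi fun j hj hji => by
          rw [hv0 i hi j hj hji.symm, mul_zero], hv1 i hi, mul_one]
        have h2 : s i / eval x (f i) = -∑ j ∈ Iᶜ, t j / eval x (f j) * (φ j ⬝ᵥ v i) := by
          simp only [s, if_pos hi]
          rw [neg_div, mul_div_cancel_left₀ _ (hx i)]
        rw [h2, neg_add_eq_zero]
        refine Finset.sum_congr rfl fun j hj => ?_
        simp only [s, if_neg (Finset.mem_compl.1 hj)]
      calc ∑ j, (s j / eval x (f j)) • φ j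
          = ∑ j, (s j / eval x (f j)) • ∑ i ∈ I, (φ j ⬝ᵥ v i) • φ i :=
            Finset.sum_congr rfl fun j _ => by rw [← hv j]
        _ = ∑ i ∈ I, (∑ j, s j / eval x (f j) * (φ j ⬝ᵥ v i)) • φ i := by
            simp only [Finset.smul_sum, Finset.sum_smul, smul_smul]
            exact Finset.sum_comm
        _ = 0 := Finset.sum_eq_zero fun i hi => by rw [h1 i hi, zero_smul]
    rw [hg' x t s fun i hi => by simp only [s, if_neg hi], hI _ hs, mul_zero]
  have hF0 : (rename Sum.inl (∏ i, f i) : PolyRS n ι) ≠ 0 := by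
    rw [Ne, ← map_zero (rename Sum.inl), (rename_injective _ Sum.inl_injective).eq_iff]
    exact Finset.prod_ne_zero_iff.2 fun i _ => hf0 i
  rw [(mul_eq_zero.1 h0).resolve_left hF0, sub_zero] at h
  exact h

end Likelihood

section LinearForms

lemma exists_eq_linForm {g : PolyR n} (hg : g.IsHomogeneous 1) : ∃ u, g = linForm u := by
  rw [← mem_homogeneousSubmodule, homogeneousSubmodule_one_eq_span_X,
    Submodule.mem_span_range_iff_exists_fun] at hg
  obtain ⟨u, rfl⟩ := hg
  exact ⟨u, rfl⟩

lemma MvPolynomial.IsHomogeneous.prime_of_one {g : PolyR n} (hg : g.IsHomogeneous 1)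
    (h0 : g ≠ 0) : Prime g := by
  refine (irreducible_of_totalDegree_eq_one (hg.totalDegree h0) fun c hc => ?_).prime
  rw [isUnit_iff_ne_zero]
  rintro rfl
  refine h0 (MvPolynomial.ext _ _ fun d => ?_)
  rw [coeff_zero]
  exact zero_dvd_iff.1 (hc d)

end LinearForms

/-- Tame linear arrangements are gentle: if `f_1,…,f_m` are pairwise
non-proportional linear forms with `m > n` defining a tame hyperplane arrangement `A`,
then `A` is gentle, i.e. `I₀(A) = I(A)`. -/
theorem statement11 {n m : ℕ} (hmn : n < m) (f : Fin m → PolyR n)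
    (hlin : ∀ i, (f i).IsHomogeneous 1)
    (hne : ∀ i, f i ≠ 0)
    (hprop : ∀ i j, i ≠ j → ∀ c : ℂ, f i ≠ c • f j)
    (htame : IsTame f) :
    IsGentle f := by
  choose φ hf using fun i => exists_eq_linForm (hlin i)
  have hp : ∀ i, Prime (f i) := fun i => (hlin i).prime_of_one (hne i)
  have hc : Pairwise fun i j => IsRelPrime (f i) (f j) := by
    intro i j hij
    refine (hp i).irreducible.isRelPrime_iff_not_dvd.2 fun hd => ?_
    obtain ⟨u, hu⟩ := ((hp i).irreducible.dvd_irreducible_iff_associated (hp j).irreducible).1 hd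
    obtain ⟨c, -, hc⟩ := MvPolynomial.isUnit_iff_eq_C_of_isReduced.1 u.isUnit
    exact hprop j i hij.symm c (by rw [← hu, hc, mul_comm, smul_eq_C_mul])
  have : Nonempty (Fin m) := ⟨⟨n, hmn⟩⟩
  refine le_antisymm (preLikelihoodIdeal_le_likelihoodIdeal f) fun g hg => ?_
  obtain ⟨N, hN⟩ := exists_pow_mul_mem_preLikelihoodIdeal hne hf hg
  induction N with
  | zero => simpa using hN
  | succ N ih =>
    rw [pow_succ', mul_assoc] at hN
    exact ih (mem_preLikelihoodIdeal_of_mul_mem hp hc hf htame hN)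

end
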